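/- arXiv:2012.04560 — 7 statements merged into one kernel-verified Lean document; each statement's English description precedes it below -/
import Mathlib

section
/- Let G = (V,E) be a finite simple graph with n = |V| vertices and m = |E| edges, let k ≥ 3, and set Δ = 4n(n-1) - 16m/(k-1) + 1. Then the C_k-chromatic number satisfies a_k(G) ≥ (2n + 1 - √Δ)/2. -/
open SimpleGraph

/-- `f` is a `C_k`-coloring of `G`: a proper vertex coloring such that no cycle of length
at least `k` is bicolored, i.e. every such cycle receives at least 3 distinct colors. -/
def IsCkColoring {V α : Type*} [DecidableEq α] (G : SimpleGraph V) (k : ℕ) (f : V → α) : Prop :=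
  (∀ u w : V, G.Adj u w → f u ≠ f w) ∧
  ∀ (u : V) (c : G.Walk u u), c.IsCycle → k ≤ c.length →
    3 ≤ (c.support.map f).toFinset.card

/-- The `C_k`-chromatic number: the least number of colors of a `C_k`-coloring. -/
noncomputable def ckChrom {V : Type*} (G : SimpleGraph V) (k : ℕ) : ℕ :=
  sInf {n : ℕ | ∃ f : V → Fin n, IsCkColoring G k f}

open Finset in
/-- A bipartite graph of minimum degree at least `d ≥ 2` contains a cycle of length at
least `2 * d`. -/
theorem exists_isCycle_two_mul_le_length {W : Type*} [Fintype W] [Nonempty W]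
    (H : SimpleGraph W) [DecidableRel H.Adj] (c : H.Coloring Bool) (d : ℕ) (hd : 2 ≤ d)
    (hdeg : ∀ v, d ≤ H.degree v) :
    ∃ (u : W) (p : H.Walk u u), p.IsCycle ∧ 2 * d ≤ p.length := by
  classical
  obtain ⟨u, v, p, hp, hmax⟩ := Walk.exists_isPath_forall_isPath_length_le_length H
  have hsupp : ∀ w, H.Adj u w → w ∈ p.support := by
    intro w hw
    by_contra hn
    have := hmax w v (Walk.cons hw.symm p) (hp.cons hn)
    simp at this
  have hodd : ∀ w, H.Adj u w → Odd (p.support.idxOf w) := by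
    intro w hw
    rw [← p.length_takeUntil (hsupp w hw), c.odd_length_iff_not_congr]
    have := c.valid hw
    revert this
    cases c u <;> cases c w <;> simp
  obtain ⟨w, hw, hlen⟩ : ∃ w, H.Adj u w ∧ 2 * d - 1 ≤ p.support.idxOf w := by
    by_contra! hcon
    have hcard : #(H.neighborFinset u) ≤ #(range (d - 1)) := by
      refine card_le_card_of_injOn (fun w => p.support.idxOf w / 2) ?_ ?_
      · intro w hw
        have hw' : H.Adj u w := by simpa using hw
        obtain ⟨t, ht⟩ := hodd w hw'
        have := hcon w hw'
        simp only [coe_range, Set.mem_Iio]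
        omega
      · intro w hw w' hw' heq
        have h1 : H.Adj u w := by simpa using hw
        have h2 : H.Adj u w' := by simpa using hw'
        obtain ⟨t, ht⟩ := hodd w h1
        obtain ⟨t', ht'⟩ := hodd w' h2
        have hidx : p.support.idxOf w = p.support.idxOf w' := by
          simp only at heq
          omega
        rw [← p.getVert_support_idxOf (hsupp w h1), hidx,
          p.getVert_support_idxOf (hsupp w' h2)]
    have := hdeg u
    rw [card_neighborFinset_eq_degree, card_range] at hcard
    omega
  have hlen' := p.length_takeUntil (hsupp w hw)
  have hpath := hp.takeUntil (hsupp w hw)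
  refine ⟨w, Walk.cons hw.symm (p.takeUntil w (hsupp w hw)), ?_, ?_⟩
  · refine (Walk.cons_isCycle_iff _ _).mpr ⟨hpath, fun hmem => ?_⟩
    have := hpath.length_eq_one_of_mem_edges (Sym2.eq_swap ▸ hmem)
    omega
  · rw [Walk.length_cons]
    omega

open Finset in
/-- In a nonempty set of vertices carrying only two colors of a `C_k`-coloring, some vertex has
few neighbors inside the set. -/
theorem IsCkColoring.exists_two_mul_card_lt {V α : Type*} [DecidableEq α]
    {G : SimpleGraph V} [DecidableRel G.Adj] {k : ℕ} {f : V → α} (hf : IsCkColoring G k f)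
    (hk : 3 ≤ k) (i j : α) (S : Finset V) (hS : S.Nonempty) (hij : ∀ v ∈ S, f v = i ∨ f v = j) :
    ∃ v ∈ S, 2 * #{w ∈ S | G.Adj v w} < k := by
  classical
  by_contra! hcon
  let H : SimpleGraph S := G.induce (S : Set V)
  have : Nonempty S := hS.to_subtype
  let c : H.Coloring Bool := Coloring.mk (fun v => decide (f v = i)) (by
    intro v w hvw
    have h1 : f v ≠ f w := hf.1 _ _ hvw
    have h2 := hij v v.2
    have h3 := hij w w.2
    rw [Ne, decide_eq_decide]
    grind)
  obtain ⟨u, p, hp, hlen⟩ := exists_isCycle_two_mul_le_length H c ((k + 1) / 2) (by omega) (by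
    intro v
    have h1 := hcon v v.2
    have h2 : #{w ∈ S | G.Adj v w} ≤ H.degree v := by
      rw [← card_neighborFinset_eq_degree]
      refine card_le_card_of_surjOn (fun w => (w : V)) fun w hw => ?_
      simp only [coe_filter, Set.mem_ofPred_eq] at hw
      exact ⟨⟨w, hw.1⟩, by simpa [H] using hw.2, rfl⟩
    omega)
  let e := Embedding.induce (G := G) (S : Set V)
  have hcyc : (p.map e.toHom).IsCycle := hp.map e.injective
  have h3 := hf.2 _ (p.map e.toHom) hcyc (by rw [Walk.length_map]; omega)
  have h2 : (((p.map e.toHom).support.map f).toFinset) ⊆ {i, j} := by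
    intro a ha
    simp only [Walk.support_map, List.map_map, List.mem_toFinset, List.mem_map] at ha
    obtain ⟨v, -, rfl⟩ := ha
    exact Finset.mem_insert.mpr ((hij v v.2).imp_right Finset.mem_singleton.mpr)
  have := (card_le_card h2).trans card_le_two
  omega

open Finset in
/-- A nonempty set of vertices carrying only two colors of a `C_k`-coloring spans at most
`(k - 1) * (#S - 1) / 2` edges. -/
theorem IsCkColoring.card_filter_adj_le {V α : Type*} [DecidableEq α]
    {G : SimpleGraph V} [DecidableRel G.Adj] {k : ℕ} {f : V → α} (hf : IsCkColoring G k f)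
    (hk : 3 ≤ k) (i j : α) (S : Finset V) (hS : S.Nonempty) (hij : ∀ v ∈ S, f v = i ∨ f v = j) :
    (∑ v ∈ S, ∑ w ∈ S, if G.Adj v w then (1 : ℝ) else 0) ≤ (k - 1) * (#S - 1) := by
  classical
  induction hn : #S generalizing S with
  | zero => simp_all
  | succ n ih =>
    obtain ⟨v, hv, hlt⟩ := hf.exists_two_mul_card_lt hk i j S hS hij
    have hcard : #(S.erase v) = n := by rw [card_erase_of_mem hv, hn]; rfl
    have hdeg : (2 : ℝ) * (∑ w ∈ S, if G.Adj v w then (1 : ℝ) else 0) ≤ k - 1 := by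
      rw [sum_boole, le_sub_iff_add_le]
      exact_mod_cast hlt
    have hsplit : (∑ a ∈ S, ∑ w ∈ S, if G.Adj a w then (1 : ℝ) else 0) =
        2 * (∑ w ∈ S, if G.Adj v w then (1 : ℝ) else 0) +
          ∑ a ∈ S.erase v, ∑ w ∈ S.erase v, if G.Adj a w then (1 : ℝ) else 0 := by
      have hcol : ∀ a, (∑ w ∈ S, if G.Adj a w then (1 : ℝ) else 0) =
          (∑ w ∈ S.erase v, if G.Adj a w then (1 : ℝ) else 0) +
            if G.Adj v a then 1 else 0 := by
        intro a
        simp only [G.adj_comm v a, sum_erase_add _ _ hv]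
      rw [← sum_erase_add _ _ hv, sum_congr rfl fun a _ => hcol a, sum_add_distrib,
        hcol v]
      simp only [SimpleGraph.irrefl, if_false, add_zero]
      ring
    rcases (S.erase v).eq_empty_or_nonempty with he | hne
    · have h0 : S = {v} := by
        rw [← insert_erase hv, he]; rfl
      have hn0 : n = 0 := by rw [← hcard, he, card_empty]
      subst h0 hn0
      simp
    · have := ih (S.erase v) hne (fun w hw => hij w (mem_of_mem_erase hw)) hcard
      rw [hsplit]
      push_cast
      linarith

open Finset in
/-- The edge bound for a `C_k`-coloring using exactly `x` colors, summed over all pairs of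
color classes. -/
theorem IsCkColoring.four_mul_card_edgeFinset_le {V α : Type*} [Fintype V] [DecidableEq α]
    {G : SimpleGraph V} [DecidableRel G.Adj] {k : ℕ} {f : V → α} (hf : IsCkColoring G k f)
    (hk : 3 ≤ k) :
    4 * (#G.edgeFinset : ℝ) ≤ (k - 1) * ((#(univ.image f) - 1) *
      (2 * Fintype.card V - #(univ.image f))) := by
  classical
  set T := univ.image f with hT
  let C : α → Finset V := fun i => {v | f v = i}
  let E : α → α → ℝ := fun i j => ∑ v ∈ C i, ∑ w ∈ C j, if G.Adj v w then 1 else 0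
  have hmaps : ∀ v ∈ (univ : Finset V), f v ∈ T := fun v _ => mem_image_of_mem f (mem_univ v)
  have hdiag : ∀ i, E i i = 0 := by
    intro i
    refine sum_eq_zero fun v hv => sum_eq_zero fun w hw => if_neg fun h => hf.1 v w h ?_
    simp only [C, mem_filter, mem_univ, true_and] at hv hw
    rw [hv, hw]
  have hpair : ∀ i ∈ T, ∀ j ∈ T, i ≠ j →
      E i j + E j i ≤ (k - 1) * (#(C i) + #(C j) - 1) := by
    intro i hi j hj hne
    have hdisj : Disjoint (C i) (C j) := by
      rw [Finset.disjoint_left]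
      intro v hv hw
      simp only [C, mem_filter, mem_univ, true_and] at hv hw
      exact hne (hv.symm.trans hw)
    have hnonempty : (C i ∪ C j).Nonempty := by
      obtain ⟨v, -, hv⟩ := mem_image.mp hi
      exact ⟨v, by simp [C, hv]⟩
    have h := hf.card_filter_adj_le hk i j (C i ∪ C j) hnonempty (by
      intro v hv
      simpa [C] using hv)
    rw [sum_union hdisj] at h
    simp only [sum_union hdisj, sum_add_distrib, card_union_of_disjoint hdisj] at h
    have h1 := hdiag i
    have h2 := hdiag j
    simp only [E] at h1 h2 ⊢
    push_cast at h
    linarith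
  have hedges : ∑ i ∈ T, ∑ j ∈ T, E i j = 2 * (#G.edgeFinset : ℝ) := by
    have hsum : ∀ g : V → ℝ, ∑ i ∈ T, ∑ v ∈ C i, g v = ∑ v, g v :=
      fun g => sum_fiberwise_of_maps_to hmaps g
    have h1 : ∀ i, ∑ j ∈ T, E i j = ∑ v ∈ C i, ∑ w, if G.Adj v w then (1 : ℝ) else 0 := by
      intro i
      rw [sum_comm]
      exact sum_congr rfl fun v _ => hsum _
    rw [sum_congr rfl fun i _ => h1 i, hsum]
    have h2 := G.sum_degrees_eq_twice_card_edges
    have h3 : ∀ v, (∑ w, if G.Adj v w then (1 : ℝ) else 0) = G.degree v := by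
      intro v
      rw [sum_boole, ← card_neighborFinset_eq_degree, neighborFinset_eq_filter]
    simp only [h3]
    exact_mod_cast h2
  have hclass : ∑ i ∈ T, (#(C i) : ℝ) = Fintype.card V := by
    have := card_eq_sum_card_fiberwise hmaps
    rw [← card_univ, this]
    push_cast
    rfl
  have hle : ∑ i ∈ T, ∑ j ∈ T, (E i j + E j i) ≤
      ∑ i ∈ T, ∑ j ∈ T, ((k - 1) * (#(C i) + #(C j) - 1) -
        if i = j then (k - 1 : ℝ) * (2 * #(C i) - 1) else 0) := by
    refine sum_le_sum fun i hi => sum_le_sum fun j hj => ?_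
    by_cases h : i = j
    · subst h
      rw [hdiag, if_pos rfl]
      apply le_of_eq
      ring
    · rw [if_neg h, sub_zero]
      exact hpair i hi j hj h
  have hL : ∑ i ∈ T, ∑ j ∈ T, (E i j + E j i) = 4 * (#G.edgeFinset : ℝ) := by
    simp only [sum_add_distrib]
    rw [sum_comm (f := fun i j => E j i), hedges]
    ring
  have hR : ∑ i ∈ T, ∑ j ∈ T, ((k - 1) * (#(C i) + #(C j) - 1) -
        if i = j then (k - 1 : ℝ) * (2 * #(C i) - 1) else 0) =
      (k - 1) * ((#T - 1) * (2 * Fintype.card V - #T)) := by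
    simp only [sum_sub_distrib, ← mul_sum, sum_add_distrib, sum_const, sum_ite_eq,
      sum_ite_mem, inter_self, nsmul_eq_mul, hclass]
    ring
  rw [hL, hR] at hle
  exact hle

/-- An injective coloring is a `C_k`-coloring, so the `C_k`-chromatic number is attained. -/
theorem exists_isCkColoring_ckChrom {V : Type*} [Fintype V] (G : SimpleGraph V) (k : ℕ) :
    ∃ f : V → Fin (ckChrom G k), IsCkColoring G k f := by
  classical
  refine Nat.sInf_mem (s := {n : ℕ | ∃ f : V → Fin n, IsCkColoring G k f})
    ⟨Fintype.card V, Fintype.equivFin V, fun u w h => ?_, fun u c hc _ => ?_⟩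
  · simpa using h.ne
  · have h1 : (c.support.tail.map (Fintype.equivFin V)).toFinset.card = c.length := by
      rw [List.toFinset_card_of_nodup
        (hc.support_nodup.map (Fintype.equivFin V).injective)]
      simp
    calc 3 ≤ c.length := hc.three_le_length
      _ = _ := h1.symm
      _ ≤ _ := Finset.card_le_card fun a ha => by
        simp only [List.mem_toFinset, List.mem_map] at ha ⊢
        obtain ⟨v, hv, rfl⟩ := ha
        exact ⟨v, List.mem_of_mem_tail hv, rfl⟩

theorem ck_chromatic_lower_bound {V : Type*} [Fintype V] [DecidableEq V]
    (G : SimpleGraph V) [DecidableRel G.Adj] (k : ℕ) (hk : 3 ≤ k) :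
    (2 * (Fintype.card V : ℝ) + 1 -
        Real.sqrt (4 * (Fintype.card V : ℝ) * ((Fintype.card V : ℝ) - 1) -
          16 * (G.edgeFinset.card : ℝ) / ((k : ℝ) - 1) + 1)) / 2 ≤ (ckChrom G k : ℝ) := by
  obtain ⟨f, hf⟩ := exists_isCkColoring_ckChrom G k
  have hbound := hf.four_mul_card_edgeFinset_le hk
  have hx : ((Finset.univ.image f).card : ℝ) ≤ ckChrom G k := by
    exact_mod_cast (Finset.card_le_univ _).trans_eq (Fintype.card_fin _)
  set x : ℝ := ((Finset.univ.image f).card : ℝ)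
  have hk1 : (0 : ℝ) < k - 1 := by
    have : (3 : ℝ) ≤ k := by exact_mod_cast hk
    linarith
  have hdiv : 16 * (G.edgeFinset.card : ℝ) / ((k : ℝ) - 1) ≤
      4 * ((x - 1) * (2 * Fintype.card V - x)) := by
    rw [div_le_iff₀ hk1]
    linarith
  have hsqrt := Real.le_sqrt_of_sq_le (x := 2 * (Fintype.card V : ℝ) + 1 - 2 * x)
    (y := 4 * (Fintype.card V : ℝ) * ((Fintype.card V : ℝ) - 1) -
      16 * (G.edgeFinset.card : ℝ) / ((k : ℝ) - 1) + 1) (by linarith)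
  linarith
end

section
/- For every finite simple graph G with maximum degree d ≥ 2 and every integer k ≥ 4, the P_k-chromatic number satisfies s_k(G) ≤ ⌈6√10 · d^{(k-1)/(k-2)}⌉. -/
open SimpleGraph

/-- `f` is a `P_k`-coloring of `G`: a proper vertex coloring such that no path on `k`
vertices is bicolored, i.e. every path on `k` vertices receives at least 3 distinct colors. -/
def IsPkColoring {V α : Type*} [DecidableEq α] (G : SimpleGraph V) (k : ℕ) (f : V → α) : Prop :=
  (∀ u w : V, G.Adj u w → f u ≠ f w) ∧
  ∀ (u w : V) (p : G.Walk u w), p.IsPath → p.length + 1 = k →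
    3 ≤ (p.support.map f).toFinset.card

/-- The `P_k`-chromatic number: the least number of colors of a `P_k`-coloring. -/
noncomputable def pkChrom {V : Type*} (G : SimpleGraph V) (k : ℕ) : ℕ :=
  sInf {n : ℕ | ∃ f : V → Fin n, IsPkColoring G k f}

/-- Consecutive entries of `p` are adjacent in `G`. -/
def IsWalkSeq {V : Type*} (G : SimpleGraph V) {k : ℕ} (p : Fin k → V) : Prop :=
  ∀ i j : Fin k, j.val = i.val + 1 → G.Adj (p i) (p j)

/-- `f` is constant on the even positions of `p` and constant on the odd positions of `p`. -/
def Alternates {V α : Type*} {k : ℕ} (f : V → α) (p : Fin k → V) : Prop :=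
  ∀ i j : Fin k, i.val % 2 = j.val % 2 → f (p i) = f (p j)

/-- `f` restricted to `S` is proper and no path on `k` vertices in `S` is bicolored; outside `S`
the value of `f` is `default`. -/
structure IsPartialPkColoring {V α : Type*} [Inhabited α] (G : SimpleGraph V) (k : ℕ)
    (S : Finset V) (f : V → α) : Prop where
  proper : ∀ u ∈ S, ∀ w ∈ S, G.Adj u w → f u ≠ f w
  path : ∀ p : Fin k → V, Function.Injective p → IsWalkSeq G p → (∀ i, p i ∈ S) →
    ¬ Alternates f p
  outside : ∀ u, u ∉ S → f u = default

lemma IsPartialPkColoring.isPkColoring {V α : Type*} [Fintype V] [Inhabited α] [DecidableEq α]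
    {G : SimpleGraph V} {k : ℕ} {f : V → α}
    (hf : IsPartialPkColoring G k Finset.univ f) : IsPkColoring G k f := by
  refine ⟨fun u w h => hf.proper u (Finset.mem_univ _) w (Finset.mem_univ _) h, ?_⟩
  intro u w p hp hk
  by_contra hlt
  push Not at hlt
  have hadj : ∀ i, i + 1 < k → f (p.getVert i) ≠ f (p.getVert (i + 1)) := fun i hi =>
    hf.proper _ (Finset.mem_univ _) _ (Finset.mem_univ _) (p.adj_getVert_succ (by omega))
  have hmem : ∀ i, f (p.getVert i) ∈ (p.support.map f).toFinset := fun i => by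
    rw [List.mem_toFinset]
    exact List.mem_map_of_mem (p.getVert_mem_support i)
  have hstep : ∀ i, i + 2 < k → f (p.getVert (i + 2)) = f (p.getVert i) := by
    intro i hi
    by_contra hne
    have h1 := hadj i (by omega)
    have h2 := hadj (i + 1) (by omega)
    have hsub : ({f (p.getVert i), f (p.getVert (i + 1)), f (p.getVert (i + 2))} : Finset α) ⊆
        (p.support.map f).toFinset := by
      intro x hx
      simp only [Finset.mem_insert, Finset.mem_singleton] at hx
      rcases hx with rfl | rfl | rfl <;> exact hmem _
    have hcard := Finset.card_le_card hsub
    rw [Finset.card_eq_three.mpr ⟨_, _, _, h1, fun h => hne h.symm, h2, rfl⟩] at hcard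
    omega
  have hpar : ∀ i, i < k → f (p.getVert i) = f (p.getVert (i % 2)) := by
    intro i
    induction i using Nat.strong_induction_on with
    | _ i ih =>
      intro hi
      by_cases h : i < 2
      · rw [Nat.mod_eq_of_lt h]
      · obtain ⟨j, rfl⟩ : ∃ j, i = j + 2 := ⟨i - 2, by omega⟩
        rw [hstep j hi, ih j (by omega) (by omega), Nat.add_mod_right]
  refine hf.path (fun i => p.getVert i.val) ?_ ?_ (fun _ => Finset.mem_univ _) ?_
  · intro i j hij
    apply Fin.ext
    exact hp.getVert_injOn (show i.val ≤ p.length by omega) (show j.val ≤ p.length by omega) hij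
  · intro i j hij
    simp only [hij]
    exact p.adj_getVert_succ (by omega)
  · intro i j hij
    simp only
    rw [hpar i i.2, hpar j j.2, hij]

open Classical in
/-- The number of walks on `n + 1` vertices with a prescribed vertex at a prescribed position is
at most `d ^ n` when all degrees are at most `d`. -/
lemma card_isWalkSeq_le {V : Type*} [Fintype V] (G : SimpleGraph V) [DecidableRel G.Adj] {d : ℕ}
    (hd : ∀ v, G.degree v ≤ d) (v : V) (n : ℕ) (i : Fin (n + 1)) :
    (Finset.univ.filter fun p : Fin (n + 1) → V => IsWalkSeq G p ∧ p i = v).card ≤ d ^ n := by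
  induction n with
  | zero =>
    rw [pow_zero, Finset.card_le_one]
    intro p hp q hq
    simp only [Finset.mem_filter, Finset.mem_univ, true_and] at hp hq
    funext j
    rw [show j = i from Fin.ext (by omega), hp.2, hq.2]
  | succ n ih =>
    rw [pow_succ']
    rcases Fin.eq_zero_or_eq_succ i with rfl | ⟨j, rfl⟩
    · refine le_trans (Finset.card_le_mul_card_image_of_maps_to (f := fun p => Fin.init p)
        (t := Finset.univ.filter fun p : Fin (n + 1) → V => IsWalkSeq G p ∧ p 0 = v) ?_ d ?_)
        (Nat.mul_le_mul_left d (ih 0))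
      · intro p hp
        simp only [Finset.mem_filter, Finset.mem_univ, true_and] at hp ⊢
        exact ⟨fun a b hab => hp.1 _ _ (by simpa using hab), hp.2⟩
      · intro q _
        refine le_trans (Finset.card_le_card_of_injOn (fun p => p (Fin.last _))
          (t := G.neighborFinset (q (Fin.last _))) ?_ ?_) (hd (q (Fin.last _)))
        · intro p hp
          simp only [Finset.coe_filter, Finset.mem_filter, Finset.mem_univ, true_and,
            Set.mem_ofPred_eq] at hp
          simp only [Finset.mem_coe, mem_neighborFinset]
          rw [← hp.2]
          exact hp.1.1 _ _ (by simp)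
        · intro p hp p' hp' h
          simp only [Finset.coe_filter, Finset.mem_filter, Finset.mem_univ, true_and,
            Set.mem_ofPred_eq] at hp hp' h
          rw [← Fin.snoc_init_self p, ← Fin.snoc_init_self p', hp.2, hp'.2, h]
    · refine le_trans (Finset.card_le_mul_card_image_of_maps_to (f := fun p => Fin.tail p)
        (t := Finset.univ.filter fun p : Fin (n + 1) → V => IsWalkSeq G p ∧ p j = v) ?_ d ?_)
        (Nat.mul_le_mul_left d (ih j))
      · intro p hp
        simp only [Finset.mem_filter, Finset.mem_univ, true_and] at hp ⊢
        exact ⟨fun a b hab => hp.1 _ _ (by simpa using hab), hp.2⟩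
      · intro q _
        refine le_trans (Finset.card_le_card_of_injOn (fun p => p 0)
          (t := G.neighborFinset (q 0)) ?_ ?_) (hd (q 0))
        · intro p hp
          simp only [Finset.coe_filter, Finset.mem_filter, Finset.mem_univ, true_and,
            Set.mem_ofPred_eq] at hp
          simp only [Finset.mem_coe, mem_neighborFinset]
          rw [← hp.2]
          exact (hp.1.1 0 1 (by simp)).symm
        · intro p hp p' hp' h
          simp only [Finset.coe_filter, Finset.mem_filter, Finset.mem_univ, true_and,
            Set.mem_ofPred_eq] at hp hp' h
          rw [← Fin.cons_self_tail p, ← Fin.cons_self_tail p', hp.2, hp'.2, h]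

section PartialColorings

variable {V α : Type*} [Inhabited α] {G : SimpleGraph V} {k : ℕ}

open Classical in
lemma IsPartialPkColoring.restrict {S T : Finset V} {f : V → α}
    (hf : IsPartialPkColoring G k S f) (hTS : T ⊆ S) :
    IsPartialPkColoring G k T (fun x => if x ∈ T then f x else default) where
  proper u hu w hw h := by
    simpa only [hu, hw, if_true] using hf.proper u (hTS hu) w (hTS hw) h
  path p hp hw hT h := by
    refine hf.path p hp hw (fun i => hTS (hT i)) fun i j hij => ?_
    simpa only [hT, if_true] using h i j hij
  outside u hu := by simp only [hu, if_false]

/-- If extending a partial coloring of `S` by the color `a` at `v` fails, then either `a` is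
already used on a neighbor of `v`, or some path through `v` becomes bicolored. -/
lemma IsPartialPkColoring.extension_cases [DecidableEq V] {S : Finset V} {v : V} {g : V → α}
    (hg : IsPartialPkColoring G k S g) (a : α) :
    IsPartialPkColoring G k (insert v S) (Function.update g v a) ∨
    (∃ w, G.Adj v w ∧ g w = a) ∨
    ∃ (i : Fin k) (p : Fin k → V), Function.Injective p ∧ IsWalkSeq G p ∧ p i = v ∧
      (∀ j, p j ∈ insert v S) ∧ Alternates (Function.update g v a) p := by
  by_contra hcon
  push Not at hcon
  obtain ⟨h1, h2, h3⟩ := hcon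
  refine h1 ⟨?_, ?_, ?_⟩
  · intro u hu w hw huw
    by_cases huv : u = v
    · subst huv
      rw [Function.update_self, Function.update_of_ne huw.ne']
      exact (h2 w huw).symm
    · by_cases hwv : w = v
      · subst hwv
        rw [Function.update_self, Function.update_of_ne huv]
        exact h2 u huw.symm
      · rw [Function.update_of_ne huv, Function.update_of_ne hwv]
        exact hg.proper u (Finset.mem_of_mem_insert_of_ne hu huv) w
          (Finset.mem_of_mem_insert_of_ne hw hwv) huw
  · intro p hp hw hS halt
    by_cases hv : ∃ i, p i = v
    · obtain ⟨i, hi⟩ := hv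
      exact h3 i p hp hw hi hS halt
    · push Not at hv
      refine hg.path p hp hw (fun i => Finset.mem_of_mem_insert_of_ne (hS i) (hv i))
        fun i j hij => ?_
      have := halt i j hij
      rwa [Function.update_of_ne (hv i), Function.update_of_ne (hv j)] at this
  · intro u hu
    rw [Finset.mem_insert, not_or] at hu
    rw [Function.update_of_ne hu.1]
    exact hg.outside u hu.2

/-- Away from any given position there are an even and an odd position. -/
lemma exists_even_odd_ne (hk : 4 ≤ k) (i : Fin k) :
    ∃ a b : Fin k, a.val % 2 = 0 ∧ b.val % 2 = 1 ∧ a ≠ i ∧ b ≠ i := by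
  by_cases h : i.val ≤ 1
  · exact ⟨⟨2, by omega⟩, ⟨3, by omega⟩, by simp, by simp, by simp only [ne_eq, Fin.ext_iff]; omega,
      by simp only [ne_eq, Fin.ext_iff]; omega⟩
  · exact ⟨⟨0, by omega⟩, ⟨1, by omega⟩, by simp, by simp, by simp only [ne_eq, Fin.ext_iff]; omega,
      by simp only [ne_eq, Fin.ext_iff]; omega⟩

open Classical in
/-- The finset of partial `P_k`-colorings of `G` on `S`. -/
noncomputable def partialPkColorings {V : Type*} (α : Type*) [Fintype V] [Fintype α] [Inhabited α]
    (G : SimpleGraph V) (k : ℕ) (S : Finset V) : Finset (V → α) :=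
  Finset.univ.filter (IsPartialPkColoring G k S)

variable [Fintype V] [Fintype α]

lemma mem_partialPkColorings {S : Finset V} {f : V → α} :
    f ∈ partialPkColorings α G k S ↔ IsPartialPkColoring G k S f := by
  simp [partialPkColorings]

open Classical in
/-- If one-vertex extensions multiply the number of partial colorings by at least `β`, then
extending by the set `W` multiplies it by at least `β ^ #W`. -/
lemma pow_mul_card_partialPkColorings_le {β : ℝ} (hβ : 0 ≤ β) {T W : Finset V}
    (hTW : Disjoint T W)
    (h : ∀ U : Finset V, U.card < (T ∪ W).card → ∀ v ∉ U,
      β * (partialPkColorings α G k U).card ≤ (partialPkColorings α G k (insert v U)).card) :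
    β ^ W.card * (partialPkColorings α G k T).card ≤
      ((partialPkColorings α G k (T ∪ W)).card : ℝ) := by
  induction W using Finset.induction_on with
  | empty => simp
  | insert a W ha ih =>
    have haT : a ∉ T := fun h' => Finset.disjoint_left.mp hTW h' (Finset.mem_insert_self _ _)
    have hu : T ∪ insert a W = insert a (T ∪ W) := Finset.union_insert a T W
    have hnot : a ∉ T ∪ W := by simp [haT, ha]
    rw [hu] at h ⊢
    rw [Finset.card_insert_of_notMem hnot] at h
    have h1 := ih (hTW.mono_right (Finset.subset_insert _ _)) fun U hU => h U (by omega)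
    have h2 := h (T ∪ W) (by omega) a hnot
    rw [Finset.card_insert_of_notMem ha, pow_succ', mul_assoc]
    exact (mul_le_mul_of_nonneg_left h1 hβ).trans h2

open Classical in
/-- The extensions that make a given path through `v` bicolored are determined by the coloring
outside `k - 2` vertices of the path. -/
lemma card_alternating_extensions_le (hk : 4 ≤ k) {β : ℝ} (hβ : 0 < β) {S : Finset V} {v : V}
    (hv : v ∉ S)
    (h : ∀ U : Finset V, U.card < S.card → ∀ w ∉ U,
      β * (partialPkColorings α G k U).card ≤ (partialPkColorings α G k (insert w U)).card)
    {i : Fin k} {p : Fin k → V} (hp : Function.Injective p) (hpi : p i = v)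
    (hS : ∀ j, p j ∈ insert v S) :
    (((partialPkColorings α G k S ×ˢ (Finset.univ : Finset α)).filter
      fun x => Alternates (Function.update x.1 v x.2) p).card : ℝ) ≤
      (partialPkColorings α G k S).card / β ^ (k - 3) := by
  obtain ⟨a, b, ha, hb, hai, hbi⟩ := exists_even_odd_ne hk i
  have hab : a ≠ b := by rintro rfl; omega
  have hav : p a ≠ v := fun h' => hai (hp (h'.trans hpi.symm))
  have hbv : p b ≠ v := fun h' => hbi (hp (h'.trans hpi.symm))
  have haS : p a ∈ S := Finset.mem_of_mem_insert_of_ne (hS a) hav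
  have hbS : p b ∈ S := Finset.mem_of_mem_insert_of_ne (hS b) hbv
  set W : Finset V := (({a, b} : Finset (Fin k))ᶜ.erase i).image p with hW
  have hWcard : W.card = k - 3 := by
    rw [hW, Finset.card_image_of_injective _ hp, Finset.card_erase_of_mem, Finset.card_compl,
      Finset.card_pair hab, Fintype.card_fin]
    · omega
    · simp [hai.symm, hbi.symm]
  have hWS : W ⊆ S := by
    intro x hx
    simp only [hW, Finset.mem_image, Finset.mem_erase] at hx
    obtain ⟨j, ⟨hji, _⟩, rfl⟩ := hx
    exact Finset.mem_of_mem_insert_of_ne (hS j) fun h' => hji (hp (h'.trans hpi.symm))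
  have haW : p a ∉ W := by
    simp only [hW, Finset.mem_image, Finset.mem_erase, Finset.mem_compl]
    rintro ⟨j, ⟨_, hj⟩, hja⟩
    exact hj (by simp [hp hja])
  have hbW : p b ∉ W := by
    simp only [hW, Finset.mem_image, Finset.mem_erase, Finset.mem_compl]
    rintro ⟨j, ⟨_, hj⟩, hja⟩
    exact hj (by simp [hp hja])
  have hext := pow_mul_card_partialPkColorings_le (α := α) (G := G) (k := k) hβ.le
    (T := S \ W) (W := W) Finset.sdiff_disjoint (by rwa [Finset.sdiff_union_of_subset hWS])
  rw [Finset.sdiff_union_of_subset hWS, hWcard] at hext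
  rw [le_div_iff₀ (pow_pos hβ _), mul_comm]
  refine le_trans (mul_le_mul_of_nonneg_left ?_ (pow_pos hβ _).le) hext
  rw [Nat.cast_le]
  refine Finset.card_le_card_of_injOn
    (fun x => fun u => if u ∈ S \ W then x.1 u else default) ?_ ?_
  · rintro ⟨g, c⟩ hx
    simp only [Finset.coe_filter, Finset.mem_product, Set.mem_ofPred_eq] at hx
    exact mem_partialPkColorings.mpr
      ((mem_partialPkColorings.mp hx.1.1).restrict Finset.sdiff_subset)
  · rintro ⟨g, c⟩ hx ⟨g', c'⟩ hx' heq
    simp only [Finset.coe_filter, Finset.mem_product, Set.mem_ofPred_eq, Finset.mem_univ, and_true,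
      mem_partialPkColorings] at hx hx'
    have hT : ∀ u ∈ S \ W, g u = g' u := fun u hu => by
      simpa only [hu, if_true] using congrFun heq u
    have hga := hT (p a) (Finset.mem_sdiff.mpr ⟨haS, haW⟩)
    have hgb := hT (p b) (Finset.mem_sdiff.mpr ⟨hbS, hbW⟩)
    have hpath : ∀ j, Function.update g v c (p j) = Function.update g' v c' (p j) := by
      intro j
      rcases Nat.mod_two_eq_zero_or_one j.val with hj | hj
      · rw [hx.2 j a (hj.trans ha.symm), hx'.2 j a (hj.trans ha.symm),
          Function.update_of_ne hav, Function.update_of_ne hav, hga]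
      · rw [hx.2 j b (hj.trans hb.symm), hx'.2 j b (hj.trans hb.symm),
          Function.update_of_ne hbv, Function.update_of_ne hbv, hgb]
    refine Prod.ext ?_ ?_
    · funext u
      by_cases huS : u ∈ S
      · by_cases huW : u ∈ W
        · have huv : u ≠ v := fun h' => hv (h' ▸ huS)
          obtain ⟨j, -, rfl⟩ := Finset.mem_image.mp huW
          have := hpath j
          rwa [Function.update_of_ne huv, Function.update_of_ne huv] at this
        · exact hT u (Finset.mem_sdiff.mpr ⟨huS, huW⟩)
      · exact (hx.1.outside u huS).trans (hx'.1.outside u huS).symm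
    · have := hpath i
      rwa [hpi, Function.update_self, Function.update_self] at this

open Classical in
lemma mul_card_partialPkColorings_le [DecidableRel G.Adj] (hk : 4 ≤ k) {d : ℕ}
    (hd : ∀ v, G.degree v ≤ d) {β : ℝ} (hβ : 0 < β)
    (hcard : β + d + k * d ^ (k - 1) / β ^ (k - 3) ≤ (Fintype.card α : ℝ))
    (S : Finset V) (v : V) (hv : v ∉ S) :
    β * (partialPkColorings α G k S).card ≤
      ((partialPkColorings α G k (insert v S)).card : ℝ) := by
  induction hn : S.card using Nat.strong_induction_on generalizing S v with
  | _ n ih =>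
    have h : ∀ U : Finset V, U.card < S.card → ∀ w ∉ U, β * (partialPkColorings α G k U).card ≤
        ((partialPkColorings α G k (insert w U)).card : ℝ) :=
      fun U hU w hw => ih U.card (hn ▸ hU) U w hw rfl
    set N : ℝ := ((partialPkColorings α G k S).card : ℝ) with hN
    set E := partialPkColorings α G k S ×ˢ (Finset.univ : Finset α) with hE
    let A := E.filter fun x => Function.update x.1 v x.2 ∈ partialPkColorings α G k (insert v S)
    let B := (G.neighborFinset v).biUnion fun w => E.filter fun x => x.1 w = x.2
    let paths := fun i : Fin k => (Finset.univ.filter fun p : Fin k → V =>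
      IsWalkSeq G p ∧ p i = v).filter fun p => Function.Injective p ∧ ∀ j, p j ∈ insert v S
    let C := (Finset.univ : Finset (Fin k)).biUnion fun i => (paths i).biUnion fun p =>
      E.filter fun x => Alternates (Function.update x.1 v x.2) p
    have hcover : E ⊆ A ∪ (B ∪ C) := by
      rintro ⟨g, a⟩ hx
      have hg := mem_partialPkColorings.mp (Finset.mem_product.mp hx).1
      rw [Finset.mem_union, Finset.mem_union]
      rcases hg.extension_cases (v := v) a with h1 | ⟨w, hw, hwa⟩ | ⟨i, p, hp, hwp, hpi, hpS, halt⟩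
      · exact Or.inl (Finset.mem_filter.mpr ⟨hx, mem_partialPkColorings.mpr h1⟩)
      · refine Or.inr (Or.inl (Finset.mem_biUnion.mpr ⟨w, ?_, Finset.mem_filter.mpr ⟨hx, hwa⟩⟩))
        exact (G.mem_neighborFinset v w).mpr hw
      · refine Or.inr (Or.inr (Finset.mem_biUnion.mpr ⟨i, Finset.mem_univ _,
          Finset.mem_biUnion.mpr ⟨p, ?_, Finset.mem_filter.mpr ⟨hx, halt⟩⟩⟩))
        simp only [paths, Finset.mem_filter, Finset.mem_univ, true_and]
        exact ⟨⟨hwp, hpi⟩, hp, hpS⟩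
    have hA : A.card ≤ (partialPkColorings α G k (insert v S)).card := by
      refine Finset.card_le_card_of_injOn (fun x => Function.update x.1 v x.2) ?_ ?_
      · intro x hx
        exact (Finset.mem_filter.mp hx).2
      · rintro ⟨g, a⟩ hx ⟨g', a'⟩ hx' heq
        have hg := mem_partialPkColorings.mp
          (Finset.mem_product.mp (Finset.mem_filter.mp hx).1).1
        have hg' := mem_partialPkColorings.mp
          (Finset.mem_product.mp (Finset.mem_filter.mp hx').1).1
        refine Prod.ext (funext fun u => ?_) ?_
        · by_cases huv : u = v
          · subst huv
            exact (hg.outside u hv).trans (hg'.outside u hv).symm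
          · have := congrFun heq u
            simpa only [Function.update_of_ne huv] using this
        · simpa only [Function.update_self] using congrFun heq v
    have hB : B.card ≤ d * (partialPkColorings α G k S).card := by
      refine (Finset.card_biUnion_le_card_mul _ _ (partialPkColorings α G k S).card ?_).trans
        (Nat.mul_le_mul_right _ (hd v))
      intro w _
      refine Finset.card_le_card_of_injOn Prod.fst ?_ ?_
      · intro x hx
        exact (Finset.mem_product.mp (Finset.mem_filter.mp hx).1).1
      · intro x hx y hy hxy
        refine Prod.ext hxy ?_
        rw [← (Finset.mem_filter.mp hx).2, ← (Finset.mem_filter.mp hy).2, hxy]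
    have hpaths : ∀ i, ((paths i).card : ℝ) ≤ (d : ℝ) ^ (k - 1) := by
      intro i
      obtain ⟨m, rfl⟩ : ∃ m, k = m + 1 := ⟨k - 1, by omega⟩
      exact_mod_cast (Finset.card_filter_le _ _).trans (card_isWalkSeq_le G hd v m i)
    have hC : (C.card : ℝ) ≤ k * (d ^ (k - 1) * (N / β ^ (k - 3))) := by
      have h1 : (C.card : ℝ) ≤ ∑ i : Fin k, ∑ p ∈ paths i,
          ((E.filter fun x => Alternates (Function.update x.1 v x.2) p).card : ℝ) := by
        exact_mod_cast Finset.card_biUnion_le.trans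
          (Finset.sum_le_sum fun i _ => Finset.card_biUnion_le)
      have hNβ : 0 ≤ N / β ^ (k - 3) := div_nonneg (Nat.cast_nonneg _) (pow_pos hβ _).le
      have h2 : ∀ i : Fin k, ∑ p ∈ paths i,
          ((E.filter fun x => Alternates (Function.update x.1 v x.2) p).card : ℝ) ≤
          d ^ (k - 1) * (N / β ^ (k - 3)) := by
        intro i
        refine (Finset.sum_le_card_nsmul _ _ (N / β ^ (k - 3)) fun p hp => ?_).trans ?_
        · simp only [paths, Finset.mem_filter, Finset.mem_univ, true_and] at hp
          exact card_alternating_extensions_le hk hβ hv h hp.2.1 hp.1.2 hp.2.2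
        · rw [nsmul_eq_mul]
          exact mul_le_mul_of_nonneg_right (hpaths i) hNβ
      refine h1.trans ((Finset.sum_le_card_nsmul _ _ _ fun i _ => h2 i).trans ?_)
      rw [nsmul_eq_mul, Finset.card_univ, Fintype.card_fin]
    have hEcard : (E.card : ℝ) = N * Fintype.card α := by
      rw [hE, Finset.card_product, Finset.card_univ, Nat.cast_mul]
    have hsum : (E.card : ℝ) ≤ A.card + (B.card + C.card) := by
      exact_mod_cast (Finset.card_le_card hcover).trans
        ((Finset.card_union_le _ _).trans (Nat.add_le_add_left (Finset.card_union_le _ _) _))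
    have hA' : (A.card : ℝ) ≤ (partialPkColorings α G k (insert v S)).card := by exact_mod_cast hA
    have hB' : (B.card : ℝ) ≤ d * N := by rw [hN]; exact_mod_cast hB
    have hN0 : 0 ≤ N := Nat.cast_nonneg _
    have hmul := mul_le_mul_of_nonneg_left hcard hN0
    have hexp : N * (β + d + k * d ^ (k - 1) / β ^ (k - 3)) =
        β * N + d * N + k * (d ^ (k - 1) * (N / β ^ (k - 3))) := by ring
    linarith

/-- A graph whose degrees are at most `d` has a `P_k`-coloring with colors in `α` as soon as
`α` is large enough in terms of `d`, `k` and an auxiliary growth rate `β`. -/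
lemma exists_isPkColoring [DecidableEq α] [DecidableRel G.Adj] (hk : 4 ≤ k) {d : ℕ}
    (hd : ∀ v, G.degree v ≤ d) {β : ℝ} (hβ : 0 < β)
    (hcard : β + d + k * d ^ (k - 1) / β ^ (k - 3) ≤ (Fintype.card α : ℝ)) :
    ∃ f : V → α, IsPkColoring G k f := by
  classical
  have hpos : ∀ S : Finset V, 0 < ((partialPkColorings α G k S).card : ℝ) := by
    intro S
    induction S using Finset.induction_on with
    | empty =>
      rw [Nat.cast_pos, Finset.card_pos]
      refine ⟨fun _ => default, mem_partialPkColorings.mpr ⟨by simp, ?_, fun _ _ => rfl⟩⟩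
      intro p _ _ hS
      exact absurd (hS ⟨0, by omega⟩) (Finset.notMem_empty _)
    | insert v S hv ih =>
      exact (mul_pos hβ ih).trans_le (mul_card_partialPkColorings_le hk hd hβ hcard S v hv)
  obtain ⟨f, hf⟩ := Finset.card_pos.mp (Nat.cast_pos.mp (hpos Finset.univ))
  exact ⟨f, (mem_partialPkColorings.mp hf).isPkColoring⟩

end PartialColorings

/-- With `D = d ^ ((k - 1) / (k - 2))`, the growth rate `2 * D` is admissible for `5 * D` colors. -/
lemma growth_rate_le {d k : ℕ} (hd : 1 ≤ d) (hk : 4 ≤ k) {D : ℝ}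
    (hD : D = (d : ℝ) ^ (((k : ℝ) - 1) / ((k : ℝ) - 2))) :
    2 * D + d + k * d ^ (k - 1) / (2 * D) ^ (k - 3) ≤ 5 * D := by
  obtain ⟨m, rfl⟩ : ∃ m, k = m + 4 := ⟨k - 4, by omega⟩
  have hd1 : (1 : ℝ) ≤ d := by exact_mod_cast hd
  have hDpos : 0 < D := hD ▸ Real.rpow_pos_of_pos (by linarith) _
  have hm : (0 : ℝ) ≤ m := Nat.cast_nonneg m
  have hdD : (d : ℝ) ≤ D := by
    rw [hD]
    refine Real.self_le_rpow_of_one_le hd1 ?_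
    push_cast
    rw [le_div_iff₀ (by linarith)]
    linarith
  have hpow : (d : ℝ) ^ (m + 3) = D ^ (m + 2) := by
    rw [hD, ← Real.rpow_natCast, ← Real.rpow_natCast, ← Real.rpow_mul (by linarith)]
    congr 1
    push_cast
    field_simp [show (m : ℝ) + 4 - 2 ≠ 0 by linarith]
    ring
  have hk2 : ((m + 4 : ℕ) : ℝ) ≤ 2 * 2 ^ (m + 1) := by
    have : m + 4 ≤ 2 * 2 ^ (m + 1) := by
      have := Nat.lt_two_pow_self (n := m)
      rw [pow_succ]
      omega
    exact_mod_cast this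
  have hterm : ((m + 4 : ℕ) : ℝ) * d ^ (m + 4 - 1) / (2 * D) ^ (m + 4 - 3) ≤ 2 * D := by
    rw [show m + 4 - 1 = m + 3 by omega, show m + 4 - 3 = m + 1 by omega, hpow, mul_pow,
      div_le_iff₀ (by positivity)]
    calc ((m + 4 : ℕ) : ℝ) * D ^ (m + 2) ≤ 2 * 2 ^ (m + 1) * D ^ (m + 2) :=
          mul_le_mul_of_nonneg_right hk2 (by positivity)
      _ = 2 * D * (2 ^ (m + 1) * D ^ (m + 1)) := by ring
  linarith

theorem pk_chromatic_upper_bound {V : Type*} [Fintype V]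
    (G : SimpleGraph V) [DecidableRel G.Adj] (d k : ℕ)
    (hdeg : G.maxDegree = d) (hd : 2 ≤ d) (hk : 4 ≤ k) :
    pkChrom G k ≤ ⌈6 * Real.sqrt 10 * (d : ℝ) ^ (((k : ℝ) - 1) / ((k : ℝ) - 2))⌉₊ := by
  set D : ℝ := (d : ℝ) ^ (((k : ℝ) - 1) / ((k : ℝ) - 2)) with hD
  have hDpos : 0 < D := Real.rpow_pos_of_pos (by exact_mod_cast (by omega : 0 < d)) _
  have hsqrt : (1 : ℝ) ≤ Real.sqrt 10 := Real.one_le_sqrt.mpr (by norm_num)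
  set c : ℕ := ⌈6 * Real.sqrt 10 * D⌉₊ with hc
  have hcle : 5 * D ≤ (c : ℝ) := le_trans (by nlinarith) (Nat.le_ceil _)
  have hcpos : 0 < c := Nat.cast_pos.mp (lt_of_lt_of_le (by linarith : (0 : ℝ) < 5 * D) hcle)
  have : Inhabited (Fin c) := ⟨⟨0, hcpos⟩⟩
  refine Nat.sInf_le (exists_isPkColoring (β := 2 * D) (d := d) hk
    (fun v => hdeg ▸ G.degree_le_maxDegree v) (by linarith) ?_)
  rw [Fintype.card_fin]
  exact (growth_rate_le (by omega) hk hD).trans hcle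
end

section
/- In a finite simple graph G with maximum degree at most d, for every vertex v the number of paths on k vertices (k ≥ 2) that contain v, counted as subgraph copies of P_k (i.e., paths identified with their reverses), is at most ⌈k/2⌉ · d^{k-1}. -/
open SimpleGraph

/-- Reversal relation on paths (given as walks together with their endpoints):
two paths are related if one is the other or its reverse. -/
def PathRev {V : Type*} (G : SimpleGraph V)
    (p q : Σ u w : V, G.Walk u w) : Prop :=
  q = p ∨ q = ⟨p.2.1, p.1, p.2.2.reverse⟩

namespace SimpleGraph.Walk

variable {V : Type*} {G : SimpleGraph V} {α : Type*}

/-- The sequence of labels of the steps of a walk, where the neighbors of each vertex `u` are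
labelled by `e u`. -/
def stepLabels (e : ∀ u, G.neighborSet u → α) : ∀ {u w : V}, G.Walk u w → List α
  | _, _, nil => []
  | u, _, cons h p => e u ⟨_, h⟩ :: p.stepLabels e

theorem length_stepLabels (e : ∀ u, G.neighborSet u → α) {u w : V} (p : G.Walk u w) :
    (p.stepLabels e).length = p.length := by
  induction p with
  | nil => rfl
  | cons h p ih => simp [stepLabels, ih]

theorem eq_of_stepLabels_eq {e : ∀ u, G.neighborSet u → α} (he : ∀ u, Function.Injective (e u))
    {u w w' : V} (p : G.Walk u w) (q : G.Walk u w') (h : p.stepLabels e = q.stepLabels e) :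
    (⟨w, p⟩ : Σ x, G.Walk u x) = ⟨w', q⟩ := by
  induction p generalizing w' with
  | nil =>
    cases q with
    | nil => rfl
    | cons hq q => simp [stepLabels] at h
  | cons hp p ih =>
    cases q with
    | nil => simp [stepLabels] at h
    | cons hq q =>
      simp only [stepLabels, List.cons.injEq] at h
      have hv := congrArg Subtype.val (he _ h.1)
      dsimp only at hv
      subst hv
      cases ih q h.2
      rfl

/-- A walk through `v` splits at `v` into two walks starting at `v`. -/
theorem exists_eq_reverse_append {u w v : V} (p : G.Walk u w) (hv : v ∈ p.support) :
    ∃ (a : G.Walk v u) (b : G.Walk v w), p = a.reverse.append b := by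
  classical
  exact ⟨(p.takeUntil v hv).reverse, p.dropUntil v hv, by simp⟩

end SimpleGraph.Walk

theorem exists_neighbor_labelling {V : Type*} [Fintype V] (G : SimpleGraph V)
    [DecidableRel G.Adj] {d : ℕ} (hdeg : G.maxDegree ≤ d) :
    ∃ e : ∀ u, G.neighborSet u → Fin d, ∀ u, Function.Injective (e u) := by
  have (u : V) : ∃ e : G.neighborSet u → Fin d, Function.Injective e := by
    have h : Fintype.card (G.neighborSet u) ≤ Fintype.card (Fin d) := by
      rw [card_neighborSet_eq_degree, Fintype.card_fin]
      exact (G.degree_le_maxDegree u).trans hdeg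
    obtain ⟨e⟩ := Function.Embedding.nonempty_of_card_le h
    exact ⟨e, e.injective⟩
  choose e he using this
  exact ⟨e, he⟩

theorem count_paths_through_vertex {V : Type*} [Fintype V]
    (G : SimpleGraph V) [DecidableRel G.Adj] (d k : ℕ)
    (hdeg : G.maxDegree ≤ d) (hk : 2 ≤ k) (v : V) :
    Nat.card (Quot (fun p q : {x : Σ u w : V, G.Walk u w //
        x.2.2.IsPath ∧ x.2.2.length + 1 = k ∧ v ∈ x.2.2.support} =>
          PathRev G p.1 q.1)) ≤ (k + 1) / 2 * d ^ (k - 1) := by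
  obtain ⟨e, he⟩ := exists_neighbor_labelling G hdeg
  set r := fun p q : {x : Σ u w : V, G.Walk u w //
      x.2.2.IsPath ∧ x.2.2.length + 1 = k ∧ v ∈ x.2.2.support} => PathRev G p.1 q.1
  have key (c : Quot r) : ∃ t : Fin ((k + 1) / 2) × List.Vector (Fin d) (k - 1),
      ∃ x, Quot.mk r x = c ∧ ∃ (u w : V) (a : G.Walk v u) (b : G.Walk v w),
        x.1 = ⟨u, w, a.reverse.append b⟩ ∧ a.length = t.1 ∧
          t.2.toList = a.stepLabels e ++ b.stepLabels e := by
    obtain ⟨⟨⟨u, w, p⟩, hp, hlen, hv⟩, rfl⟩ := Quot.exists_rep c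
    obtain ⟨a, b, rfl⟩ := p.exists_eq_reverse_append hv
    have hab : a.length + b.length + 1 = k := by simpa using hlen
    by_cases hle : a.length ≤ b.length
    · exact ⟨⟨⟨a.length, by omega⟩, ⟨a.stepLabels e ++ b.stepLabels e, by
        simp only [List.length_append, Walk.length_stepLabels]; omega⟩⟩,
        _, rfl, u, w, a, b, rfl, rfl, rfl⟩
    · refine ⟨⟨⟨b.length, by omega⟩, ⟨b.stepLabels e ++ a.stepLabels e, by
        simp only [List.length_append, Walk.length_stepLabels]; omega⟩⟩,
        ⟨⟨w, u, (a.reverse.append b).reverse⟩, hp.reverse, by simp; omega,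
          by simp⟩, (Quot.sound (r := r) (Or.inr rfl)).symm, w, u, b, a, ?_, rfl, rfl⟩
      simp [Walk.reverse_append]
  choose f x hx u w a b hab hlen hlab using key
  have hf : Function.Injective f := by
    intro c c' h
    have hl : (a c).length = (a c').length := by rw [hlen, hlen, h]
    have happ : (a c).stepLabels e ++ (b c).stepLabels e =
        (a c').stepLabels e ++ (b c').stepLabels e := by rw [← hlab, ← hlab, h]
    obtain ⟨h₁, h₂⟩ := List.append_inj happ (by simpa only [Walk.length_stepLabels] using hl)
    have hA := Walk.eq_of_stepLabels_eq he _ _ h₁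
    have hB := Walk.eq_of_stepLabels_eq he _ _ h₂
    have hxx : x c = x c' := by
      apply Subtype.ext
      rw [hab, hab]
      exact congrArg₂ (fun (s t : Σ y, G.Walk v y) =>
        (⟨s.1, t.1, s.2.reverse.append t.2⟩ : Σ u w : V, G.Walk u w)) hA hB
    rw [← hx c, ← hx c', hxx]
  calc Nat.card (Quot r) ≤ Nat.card (Fin ((k + 1) / 2) × List.Vector (Fin d) (k - 1)) :=
        Nat.card_le_card_of_injective f hf
    _ = (k + 1) / 2 * d ^ (k - 1) := by simp [Nat.card_eq_fintype_card]
end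

section
/- The P_5-chromatic number of the Cartesian product P_3 □ P_3 (the 3×3 grid graph) equals 4: s_5(P_3 □ P_3) = 4. -/
open SimpleGraph

namespace IsPkColoring

/-- A `P_k`-coloring stays one after an injective relabelling of the colors. -/
theorem comp_injective {V α β : Type*} [DecidableEq α] [DecidableEq β] {G : SimpleGraph V}
    {k : ℕ} {f : V → α} (hf : IsPkColoring G k f) {e : α → β} (he : Function.Injective e) :
    IsPkColoring G k (e ∘ f) := by
  refine ⟨fun u w h => he.ne (hf.1 u w h), fun u w p hp hk => ?_⟩
  have himage : (p.support.map (e ∘ f)).toFinset = (p.support.map f).toFinset.image e := by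
    ext
    simp
  rw [himage, Finset.card_image_of_injective _ he]
  exact hf.2 u w p hp hk

/-- The colors along a path on five vertices do not alternate in a `P_5`-coloring. -/
theorem not_alternating {V α : Type*} [DecidableEq α] {G : SimpleGraph V} {f : V → α}
    (hf : IsPkColoring G 5 f) {v₀ v₁ v₂ v₃ v₄ : V} (h₀ : G.Adj v₀ v₁) (h₁ : G.Adj v₁ v₂)
    (h₂ : G.Adj v₂ v₃) (h₃ : G.Adj v₃ v₄) (hd : [v₀, v₁, v₂, v₃, v₄].Nodup) :
    ¬(f v₀ = f v₂ ∧ f v₂ = f v₄ ∧ f v₁ = f v₃) := by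
  rintro ⟨h02, h24, h13⟩
  have h := hf.2 v₀ v₄ (.cons h₀ (.cons h₁ (.cons h₂ (.cons h₃ .nil))))
    ((Walk.isPath_def _).2 hd) rfl
  have hsub : (Walk.support (.cons h₀ (.cons h₁ (.cons h₂ (.cons h₃ .nil)))) |>.map
      f).toFinset ⊆ {f v₀, f v₁} := by
    intro x hx
    simp only [Walk.support_cons, Walk.support_nil, List.map_cons, List.map_nil,
      List.mem_toFinset, List.mem_cons, List.not_mem_nil] at hx
    simp only [Finset.mem_insert, Finset.mem_singleton]
    grind
  have := (Finset.card_le_card hsub).trans Finset.card_le_two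
  omega

end IsPkColoring

/-- The coloring of the 3×3 grid by the parities of both coordinates. -/
def parityColor (v : Fin 3 × Fin 3) : Fin 4 :=
  ⟨v.1.val % 2 + 2 * (v.2.val % 2), by omega⟩

theorem parityColor_ne_of_adj {u w : Fin 3 × Fin 3}
    (h : ((pathGraph 3).boxProd (pathGraph 3)).Adj u w) : parityColor u ≠ parityColor w := by
  simp only [boxProd_adj, pathGraph_adj, Fin.ext_iff] at h
  simp only [parityColor, ne_eq, Fin.mk.injEq]
  omega

/-- The parity coloring does not alternate even along a path on four vertices. -/
theorem parityColor_not_alternating {u a b c : Fin 3 × Fin 3}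
    (h₀ : ((pathGraph 3).boxProd (pathGraph 3)).Adj u a)
    (h₁ : ((pathGraph 3).boxProd (pathGraph 3)).Adj a b)
    (h₂ : ((pathGraph 3).boxProd (pathGraph 3)).Adj b c) (hub : u ≠ b) (hac : a ≠ c) :
    ¬(parityColor u = parityColor b ∧ parityColor a = parityColor c) := by
  simp only [boxProd_adj, pathGraph_adj, Fin.ext_iff] at h₀ h₁ h₂
  simp only [ne_eq, Prod.ext_iff, Fin.ext_iff] at hub hac
  simp only [parityColor, Fin.mk.injEq]
  omega

/-- Coloring the 3×3 grid by the parities of both coordinates gives a `P_5`-coloring. -/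
theorem isPkColoring_parity :
    IsPkColoring ((pathGraph 3).boxProd (pathGraph 3)) 5
      parityColor := by
  constructor
  · exact fun u w h => parityColor_ne_of_adj h
  · intro u w p hp hk
    match p, hp, hk with
    | .cons (v := a) h₀ (.cons (v := b) h₁ (.cons (v := c) h₂ (.cons h₃ .nil))), hp, _ =>
      have hd := (Walk.isPath_def _).1 hp
      by_cases hub : parityColor u = parityColor b
      · have hac : parityColor a ≠ parityColor c := by
          intro hac
          simp only [Walk.support_cons, Walk.support_nil, List.nodup_cons, List.mem_cons,
            not_or] at hd
          exact parityColor_not_alternating h₀ h₁ h₂ hd.1.2.1 hd.2.1.2.1 ⟨hub, hac⟩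
        exact Finset.two_lt_card.2 ⟨_, by simp, _, by simp, _, by simp,
          parityColor_ne_of_adj h₁, hac, parityColor_ne_of_adj h₂⟩
      · exact Finset.two_lt_card.2 ⟨_, by simp, _, by simp, _, by simp,
          parityColor_ne_of_adj h₀, hub, parityColor_ne_of_adj h₁⟩

/-- The 3×3 grid has no `P_5`-coloring with three colors. -/
theorem not_isPkColoring_fin_three (f : Fin 3 × Fin 3 → Fin 3) :
    ¬IsPkColoring ((pathGraph 3).boxProd (pathGraph 3)) 5 f := by
  intro hf
  have hadj (u w : Fin 3 × Fin 3) (h : (u.1.val + 1 = w.1.val ∨ w.1.val + 1 = u.1.val) ∧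
      u.2 = w.2 ∨ (u.2.val + 1 = w.2.val ∨ w.2.val + 1 = u.2.val) ∧ u.1 = w.1) :
      ((pathGraph 3).boxProd (pathGraph 3)).Adj u w := by
    simpa only [boxProd_adj, pathGraph_adj] using h
  have hp (v₀ v₁ v₂ v₃ v₄) h₀ h₁ h₂ h₃ (hd : [v₀, v₁, v₂, v₃, v₄].Nodup) :=
    hf.not_alternating (hadj v₀ v₁ h₀) (hadj v₁ v₂ h₁) (hadj v₂ v₃ h₂) (hadj v₃ v₄ h₃) hd
  have he (u w) h := hf.1 u w (hadj u w h)
  have e₁ := he (1, 1) (0, 1) (by simp)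
  have e₂ := he (1, 1) (1, 0) (by simp)
  have e₃ := he (1, 1) (1, 2) (by simp)
  have e₄ := he (1, 1) (2, 1) (by simp)
  have e₅ := he (0, 0) (0, 1) (by simp)
  have e₆ := he (0, 0) (1, 0) (by simp)
  have e₇ := he (0, 2) (0, 1) (by simp)
  have e₈ := he (0, 2) (1, 2) (by simp)
  have e₉ := he (2, 0) (1, 0) (by simp)
  have e₁₀ := he (2, 0) (2, 1) (by simp)
  have e₁₁ := he (2, 2) (1, 2) (by simp)
  have e₁₂ := he (2, 2) (2, 1) (by simp)
  have p₁ := hp (0, 0) (0, 1) (1, 1) (1, 2) (2, 2)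
    (by simp) (by simp) (by simp) (by simp) (by decide)
  have p₂ := hp (0, 2) (0, 1) (1, 1) (1, 0) (2, 0)
    (by simp) (by simp) (by simp) (by simp) (by decide)
  have p₃ := hp (1, 0) (2, 0) (2, 1) (2, 2) (1, 2)
    (by simp) (by simp) (by simp) (by simp) (by decide)
  have p₄ := hp (0, 0) (0, 1) (1, 1) (2, 1) (2, 0)
    (by simp) (by simp) (by simp) (by simp) (by decide)
  have p₅ := hp (0, 1) (0, 0) (1, 0) (2, 0) (2, 1)
    (by simp) (by simp) (by simp) (by simp) (by decide)
  have p₆ := hp (0, 0) (1, 0) (1, 1) (1, 2) (0, 2)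
    (by simp) (by simp) (by simp) (by simp) (by decide)
  have p₇ := hp (1, 0) (0, 0) (0, 1) (0, 2) (1, 2)
    (by simp) (by simp) (by simp) (by simp) (by decide)
  have p₈ := hp (0, 0) (0, 1) (1, 1) (2, 1) (2, 2)
    (by simp) (by simp) (by simp) (by simp) (by decide)
  have hthree (v) : f v = 0 ∨ f v = 1 ∨ f v = 2 := by omega
  have c₁ := hthree (1, 1)
  have c₂ := hthree (0, 1)
  have c₃ := hthree (1, 0)
  have c₄ := hthree (1, 2)
  have c₅ := hthree (2, 1)
  have c₆ := hthree (0, 0)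
  have c₇ := hthree (0, 2)
  have c₈ := hthree (2, 0)
  have c₉ := hthree (2, 2)
  clear hthree hp he hadj hf
  grind (splits := 30)

theorem s5_P3_boxProd_P3 :
    pkChrom ((pathGraph 3).boxProd (pathGraph 3)) 5 = 4 := by
  refine le_antisymm (Nat.sInf_le ⟨_, isPkColoring_parity⟩)
    (le_csInf ⟨4, _, isPkColoring_parity⟩ ?_)
  rintro n ⟨f, hf⟩
  by_contra! hn
  exact not_isPkColoring_fin_three _
    (hf.comp_injective (Fin.castLE_injective (show n ≤ 3 by omega)))
end

section
/- The P_5-chromatic number of the Cartesian product C_3 □ C_3 equals 4: s_5(C_3 □ C_3) = 4. -/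
open SimpleGraph

instance SimpleGraph.decidableRelBoxProdAdj {V W : Type*} [DecidableEq V] [DecidableEq W]
    (G : SimpleGraph V) (H : SimpleGraph W) [DecidableRel G.Adj] [DecidableRel H.Adj] :
    DecidableRel (G.boxProd H).Adj :=
  fun _ _ => decidable_of_iff' _ boxProd_adj

/-- A proper coloring of `C₃ □ C₃` with at most three colors has a bicolored path on five
vertices. -/
theorem not_isPkColoring_five_C3_boxProd_C3 {n : ℕ} (hn : n ≤ 3) (f : Fin 3 × Fin 3 → Fin n) :
    ¬ IsPkColoring ((cycleGraph 3).boxProd (cycleGraph 3)) 5 f := by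
  rintro ⟨hf, hp⟩
  have row (i j k : Fin 3) (h : j ≠ k) : (f (i, j)).val ≠ (f (i, k)).val := fun e =>
    hf (i, j) (i, k) (by clear e; revert i j k; decide) (Fin.ext e)
  have col (i j k : Fin 3) (h : j ≠ k) : (f (j, i)).val ≠ (f (k, i)).val := fun e =>
    hf (j, i) (k, i) (by clear e; revert i j k; decide) (Fin.ext e)
  have lt (i j : Fin 3) : (f (i, j)).val < 3 := (f (i, j)).isLt.trans_le hn
  have path (a b c d e : Fin 3 × Fin 3)
      (hab : ((cycleGraph 3).boxProd (cycleGraph 3)).Adj a b)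
      (hbc : ((cycleGraph 3).boxProd (cycleGraph 3)).Adj b c)
      (hcd : ((cycleGraph 3).boxProd (cycleGraph 3)).Adj c d)
      (hde : ((cycleGraph 3).boxProd (cycleGraph 3)).Adj d e)
      (hnd : [a, b, c, d, e].Nodup) :
      ¬ ((f c).val = (f a).val ∧ (f d).val = (f b).val ∧ (f e).val = (f a).val) := by
    rintro ⟨hc, hd, he⟩
    have h := hp a e (.cons hab (.cons hbc (.cons hcd (.cons hde .nil))))
      (.mk' (by simpa using hnd)) rfl
    have hle : ([f a, f b, f a, f b, f a].toFinset).card ≤ 2 :=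
      (Finset.card_le_card (t := {f a, f b}) (by intro x; simp; tauto)).trans Finset.card_le_two
    simp only [Walk.support_cons, Walk.support_nil, List.map_cons, List.map_nil,
      Fin.ext hc, Fin.ext hd, Fin.ext he] at h
    omega
  have p₁ := path (0, 0) (0, 1) (2, 1) (2, 2) (1, 2) (by decide) (by decide) (by decide)
    (by decide) (by decide)
  have p₂ := path (0, 0) (0, 1) (1, 1) (1, 2) (2, 2) (by decide) (by decide) (by decide)
    (by decide) (by decide)
  have r (i : Fin 3) := And.intro (row i 0 1 (by decide))
    (And.intro (row i 0 2 (by decide)) (row i 1 2 (by decide)))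
  have c (i : Fin 3) := And.intro (col i 0 1 (by decide))
    (And.intro (col i 0 2 (by decide)) (col i 1 2 (by decide)))
  have l (i : Fin 3) := And.intro (lt i 0) (And.intro (lt i 1) (lt i 2))
  have rows := And.intro (r 0) (And.intro (r 1) (r 2))
  have cols := And.intro (c 0) (And.intro (c 1) (c 2))
  have bounds := And.intro (l 0) (And.intro (l 1) (l 2))
  clear r c l lt row col path hp hf
  grind

/-- A `P_5`-coloring of `C₃ □ C₃` with four colors. -/
def colorC3C3 (v : Fin 3 × Fin 3) : Fin 4 :=
  ![![0, 1, 2], ![1, 0, 3], ![2, 3, 0]] v.1 v.2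

set_option synthInstance.maxSize 2000 in
theorem colorC3C3_path : ∀ a b : Fin 3 × Fin 3, ((cycleGraph 3).boxProd (cycleGraph 3)).Adj a b →
    ∀ c, ((cycleGraph 3).boxProd (cycleGraph 3)).Adj b c → a ≠ c →
    ∀ d, ((cycleGraph 3).boxProd (cycleGraph 3)).Adj c d → a ≠ d → b ≠ d →
    ∀ e, ((cycleGraph 3).boxProd (cycleGraph 3)).Adj d e → a ≠ e → b ≠ e → c ≠ e →
    3 ≤ ([a, b, c, d, e].map colorC3C3).toFinset.card := by
  decide +kernel

theorem isPkColoring_colorC3C3 :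
    IsPkColoring ((cycleGraph 3).boxProd (cycleGraph 3)) 5 colorC3C3 := by
  refine ⟨by decide, fun u w p hp hl => ?_⟩
  match p, hp, hl with
  | .cons hab (.cons hbc (.cons hcd (.cons hde .nil))), hp, _ =>
    have h := hp.support_nodup
    simp only [Walk.support_cons, Walk.support_nil, List.nodup_cons, List.mem_cons,
      List.not_mem_nil, not_or, or_false] at h
    obtain ⟨⟨-, hac, had, hae⟩, ⟨-, hbd, hbe⟩, ⟨-, hce⟩, -⟩ := h
    exact colorC3C3_path _ _ hab _ hbc hac _ hcd had hbd _ hde hae hbe hce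

theorem s5_C3_boxProd_C3 :
    pkChrom ((cycleGraph 3).boxProd (cycleGraph 3)) 5 = 4 := by
  refine IsLeast.csInf_eq ⟨⟨colorC3C3, isPkColoring_colorC3C3⟩, fun n ⟨f, hf⟩ => ?_⟩
  by_contra! hn
  exact not_isPkColoring_five_C3_boxProd_C3 (by omega) f hf
end

section
/- For all integers n, m ≥ 3, the P_5-chromatic number of the n×m grid graph G(n,m) = P_n □ P_m equals 4: s_5(P_n □ P_m) = 4. -/
open SimpleGraph

theorem isPkColoring_five_iff {V α : Type*} [DecidableEq α] {G : SimpleGraph V} {f : V → α} :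
    IsPkColoring G 5 f ↔ (∀ u w : V, G.Adj u w → f u ≠ f w) ∧
      ∀ a b c d e : V, G.Adj a b → G.Adj b c → G.Adj c d → G.Adj d e → [a, b, c, d, e].Nodup →
        ¬ (f a = f c ∧ f c = f e ∧ f b = f d) := by
  refine and_congr_right fun hf ↦ ⟨?_, ?_⟩
  · rintro h a b c d e hab hbc hcd hde hnd ⟨h₁, h₂, h₃⟩
    have := h a e (.cons hab (.cons hbc (.cons hcd (.cons hde .nil))))
      (by rw [Walk.isPath_def]; simpa using hnd) (by simp)
    simp only [Walk.support_cons, Walk.support_nil, List.map_cons, List.map_nil, h₁, h₂, h₃]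
      at this
    have hle : [f e, f d, f e, f d, f e].toFinset.card ≤ 2 := by
      have : [f e, f d, f e, f d, f e].toFinset = {f e, f d} := by ext; simp; tauto
      rw [this]
      exact Finset.card_le_two
    omega
  · intro h u w p hp hl
    obtain _ | ⟨h₁, _ | ⟨h₂, _ | ⟨h₃, _ | ⟨h₄, _ | ⟨h₅, p⟩⟩⟩⟩⟩ := p <;>
      simp only [Walk.length_cons, Walk.length_nil] at hl <;> try omega
    rename_i b c d
    have hn := h u b c d w h₁ h₂ h₃ h₄ (by simpa [Walk.isPath_def] using hp)
    have h₁ := hf _ _ h₁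
    have h₂ := hf _ _ h₂
    have h₃ := hf _ _ h₃
    have h₄ := hf _ _ h₄
    rw [Nat.succ_le_iff, Finset.two_lt_card]
    by_cases hac : f u = f c
    · by_cases hbd : f b = f d
      · exact ⟨f c, by simp, f d, by simp, f w, by simp, h₃, fun hce ↦ hn ⟨hac, hce, hbd⟩, h₄⟩
      · exact ⟨f b, by simp, f c, by simp, f d, by simp, h₂, hbd, h₃⟩
    · exact ⟨f u, by simp, f b, by simp, f c, by simp, h₁, hac, h₂⟩

theorem IsPkColoring.comp_hom {V W α : Type*} [DecidableEq α] {G : SimpleGraph V}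
    {H : SimpleGraph W} {k : ℕ} {f : V → α} (hf : IsPkColoring G k f) (φ : H →g G)
    (hφ : Function.Injective φ) : IsPkColoring H k (f ∘ φ) := by
  refine ⟨fun u w h ↦ hf.1 _ _ (φ.map_adj h), fun u w p hp hl ↦ ?_⟩
  simpa using hf.2 _ _ (p.map φ) (hp.map hφ) (by simpa using hl)

theorem IsPkColoring.injective_comp {V α β : Type*} [DecidableEq α] [DecidableEq β]
    {G : SimpleGraph V} {k : ℕ} {f : V → α} (hf : IsPkColoring G k f) {g : α → β}
    (hg : Function.Injective g) : IsPkColoring G k (g ∘ f) := by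
  refine ⟨fun u w h ↦ hg.ne (hf.1 _ _ h), fun u w p hp hl ↦ ?_⟩
  have h_image : (p.support.map (g ∘ f)).toFinset = (p.support.map f).toFinset.image g := by
    ext
    simp
  rw [h_image, Finset.card_image_of_injective _ hg]
  exact hf.2 u w p hp hl

/-- The inclusion of a smaller grid as a corner of a larger one. -/
def gridCastLE {n m n' m' : ℕ} (hn : n ≤ n') (hm : m ≤ m') :
    (pathGraph n).boxProd (pathGraph m) →g (pathGraph n').boxProd (pathGraph m') where
  toFun v := (Fin.castLE hn v.1, Fin.castLE hm v.2)
  map_rel' h := by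
    simpa [boxProd_adj, pathGraph_adj, Fin.ext_iff] using h

theorem gridCastLE_injective {n m n' m' : ℕ} (hn : n ≤ n') (hm : m ≤ m') :
    Function.Injective (gridCastLE hn hm) := by
  rintro ⟨a, b⟩ ⟨c, d⟩ h
  simpa [gridCastLE] using h

set_option synthInstance.maxHeartbeats 400000 in
set_option synthInstance.maxSize 1000 in
theorem not_isPkColoring_five_grid_three
    (f : Fin 3 × Fin 3 → Fin 3) :
    ¬ IsPkColoring ((pathGraph 3).boxProd (pathGraph 3)) 5 f := by
  intro hf
  obtain ⟨hp, hb⟩ := isPkColoring_five_iff.1 hf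
  simp only [boxProd_adj, pathGraph_adj] at hp hb
  have no_coloring :
    ∀ a : Fin 3,
    ∀ b : Fin 3,
      a ≠ b →
    ∀ c : Fin 3,
      b ≠ c →
    ∀ d : Fin 3,
      a ≠ d →
    ∀ e : Fin 3,
      d ≠ e →
      b ≠ e →
    ∀ f : Fin 3,
      e ≠ f →
      c ≠ f →
      ¬ (d = b ∧ b = f ∧ a = c) →
      ¬ (b = f ∧ f = d ∧ c = e) →
      ¬ (b = d ∧ d = f ∧ a = e) →
      ¬ (a = e ∧ e = c ∧ d = f) →
    ∀ g : Fin 3,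
      d ≠ g →
    ∀ h : Fin 3,
      g ≠ h →
      e ≠ h →
      ¬ (c = e ∧ e = g ∧ f = h) →
      ¬ (a = e ∧ e = g ∧ b = h) →
    ∀ i : Fin 3,
      h ≠ i →
      f ≠ i →
      ¬ (a = e ∧ e = i ∧ d = h) →
      ¬ (c = e ∧ e = i ∧ b = h) →
      False := by
    decide +kernel
  exact no_coloring
    (f (0, 0))
    (f (0, 1))
    (hp (0, 0) (0, 1) (by decide))
    (f (0, 2))
    (hp (0, 1) (0, 2) (by decide))
    (f (1, 0))
    (hp (0, 0) (1, 0) (by decide))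
    (f (1, 1))
    (hp (1, 0) (1, 1) (by decide))
    (hp (0, 1) (1, 1) (by decide))
    (f (1, 2))
    (hp (1, 1) (1, 2) (by decide))
    (hp (0, 2) (1, 2) (by decide))
    (hb (1, 0) (0, 0) (0, 1) (0, 2) (1, 2) (by decide) (by decide) (by decide)
      (by decide) (by decide))
    (hb (0, 1) (0, 2) (1, 2) (1, 1) (1, 0) (by decide) (by decide) (by decide)
      (by decide) (by decide))
    (hb (0, 1) (0, 0) (1, 0) (1, 1) (1, 2) (by decide) (by decide) (by decide)
      (by decide) (by decide))
    (hb (0, 0) (1, 0) (1, 1) (1, 2) (0, 2) (by decide) (by decide) (by decide)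
      (by decide) (by decide))
    (f (2, 0))
    (hp (1, 0) (2, 0) (by decide))
    (f (2, 1))
    (hp (2, 0) (2, 1) (by decide))
    (hp (1, 1) (2, 1) (by decide))
    (hb (0, 2) (1, 2) (1, 1) (2, 1) (2, 0) (by decide) (by decide) (by decide)
      (by decide) (by decide))
    (hb (0, 0) (0, 1) (1, 1) (2, 1) (2, 0) (by decide) (by decide) (by decide)
      (by decide) (by decide))
    (f (2, 2))
    (hp (2, 1) (2, 2) (by decide))
    (hp (1, 2) (2, 2) (by decide))
    (hb (0, 0) (1, 0) (1, 1) (2, 1) (2, 2) (by decide) (by decide) (by decide)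
      (by decide) (by decide))
    (hb (0, 2) (0, 1) (1, 1) (2, 1) (2, 2) (by decide) (by decide) (by decide)
      (by decide) (by decide))

/-- The color of the grid vertices `(x, y)` with `x + 2 * y` congruent to `r` modulo 8. -/
def gridColor (r : Fin 8) : Fin 4 := ![0, 1, 2, 0, 3, 1, 2, 3] r

/-- The residue of `x + 2 * y` modulo 8, which determines the color of the vertex `(x, y)`. -/
def gridResidue {n m : ℕ} (v : Fin n × Fin m) : Fin 8 := Fin.ofNat 8 (v.1 + 2 * v.2)

theorem gridResidue_sub_mem {n m : ℕ} {u v : Fin n × Fin m}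
    (h : ((pathGraph n).boxProd (pathGraph m)).Adj u v) :
    gridResidue v - gridResidue u ∈ ([1, 2, 6, 7] : List (Fin 8)) := by
  simp only [boxProd_adj, pathGraph_adj, Fin.ext_iff] at h
  simp only [gridResidue, List.mem_cons, List.not_mem_nil, Fin.ext_iff, Fin.sub_def, Fin.ofNat]
  simp
  omega

theorem gridResidue_ne {n m : ℕ} {u v w : Fin n × Fin m}
    (huv : ((pathGraph n).boxProd (pathGraph m)).Adj u v)
    (hvw : ((pathGraph n).boxProd (pathGraph m)).Adj v w) (huw : u ≠ w) :
    gridResidue u ≠ gridResidue w := by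
  simp only [boxProd_adj, pathGraph_adj, Fin.ext_iff] at huv hvw
  simp only [ne_eq, Prod.ext_iff, Fin.ext_iff] at huw
  simp only [gridResidue, ne_eq, Fin.ext_iff, Fin.ofNat]
  omega

theorem gridColor_ne : ∀ a b : Fin 8, b - a ∈ ([1, 2, 6, 7] : List (Fin 8)) →
    gridColor a ≠ gridColor b := by
  decide

theorem gridColor_not_alternating : ∀ a b : Fin 8, b - a ∈ ([1, 2, 6, 7] : List (Fin 8)) →
    ∀ c, c - b ∈ ([1, 2, 6, 7] : List (Fin 8)) → a ≠ c → gridColor a = gridColor c →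
    ∀ d, d - c ∈ ([1, 2, 6, 7] : List (Fin 8)) → b ≠ d → gridColor b = gridColor d →
    ∀ e, e - d ∈ ([1, 2, 6, 7] : List (Fin 8)) → c ≠ e → gridColor c ≠ gridColor e := by
  decide +kernel

theorem isPkColoring_gridColor (n m : ℕ) :
    IsPkColoring ((pathGraph n).boxProd (pathGraph m)) 5 (gridColor ∘ gridResidue) := by
  refine isPkColoring_five_iff.2 ⟨fun u w h ↦ gridColor_ne _ _ (gridResidue_sub_mem h), ?_⟩
  rintro a b c d e hab hbc hcd hde hnd ⟨hac, hce, hbd⟩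
  simp only [List.nodup_cons, List.mem_cons, not_or] at hnd
  exact gridColor_not_alternating _ _ (gridResidue_sub_mem hab) _ (gridResidue_sub_mem hbc)
    (gridResidue_ne hab hbc hnd.1.2.1) hac _ (gridResidue_sub_mem hcd)
    (gridResidue_ne hbc hcd hnd.2.1.2.1) hbd _ (gridResidue_sub_mem hde)
    (gridResidue_ne hcd hde hnd.2.2.1.2.1) hce

theorem s5_grid (n m : ℕ) (hn : 3 ≤ n) (hm : 3 ≤ m) :
    pkChrom ((pathGraph n).boxProd (pathGraph m)) 5 = 4 := by
  refine IsLeast.csInf_eq ⟨⟨_, isPkColoring_gridColor n m⟩, ?_⟩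
  rintro k ⟨f, hf⟩
  by_contra! hk
  exact not_isPkColoring_five_grid_three _
    ((hf.injective_comp (Fin.castLE_injective (Nat.le_of_lt_succ hk))).comp_hom
      (gridCastLE hn hm) (gridCastLE_injective hn hm))
end

section
/- For all integers m, n ≥ 4 with m ≠ 5 and n ≠ 5, the P_6-chromatic number of the Cartesian product of cycles satisfies s_6(C_m □ C_n) = 4. -/
open SimpleGraph

/-- The four neighbours of a point of the grid (truncated at the coordinate axes). -/
def gridNbrs (p : ℕ × ℕ) : List (ℕ × ℕ) :=
  [(p.1 + 1, p.2), (p.1 - 1, p.2), (p.1, p.2 + 1), (p.1, p.2 - 1)]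

/-- The neighbours of `p` have colors different from that of `p`, and no path on six vertices
starting at `p` is bicolored. The color `4` marks uncolored points. -/
def GoodAt (g : ℕ × ℕ → ℕ) (p : ℕ × ℕ) : Prop :=
  ∀ q₁ ∈ gridNbrs p, g q₁ ≠ g p ∧ (g q₁ ≠ 4 →
    ∀ q₂ ∈ gridNbrs q₁, g q₂ = g p → q₂ ≠ p →
    ∀ q₃ ∈ gridNbrs q₂, g q₃ = g q₁ → q₃ ≠ q₁ →
    ∀ q₄ ∈ gridNbrs q₃, g q₄ = g p → q₄ ≠ q₂ → q₄ ≠ p →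
    ∀ q₅ ∈ gridNbrs q₄, g q₅ = g q₁ → q₅ ≠ q₃ → q₅ = q₁)

instance (g : ℕ × ℕ → ℕ) (p : ℕ × ℕ) : Decidable (GoodAt g p) := by
  unfold GoodAt
  infer_instance

/-- Successors of a letter in cyclic words composed of the blocks `012` and `0123`. -/
def nextLetters : ℕ → List ℕ
  | 0 => [1]
  | 1 => [2]
  | 2 => [0, 3]
  | _ => [0]

/-- The words of length `n + 1` starting with `a` whose consecutive letters are related by
`nextLetters`. -/
def wordsFrom : ℕ → ℕ → List (List ℕ)
  | 0, a => [[a]]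
  | n + 1, a => (nextLetters a).flatMap fun b => (wordsFrom n b).map (a :: ·)

/-- The color of the cell in row `i` and column `j` of the basic `4 × 4` block. -/
def blockColor (i j : ℕ) : ℕ :=
  ([[2, 0, 3, 1], [1, 3, 0, 2], [3, 2, 1, 0], [0, 1, 2, 3]].getD i []).getD j 0

/-- The coloring of a grid window with row word `w` and column word `v`. -/
def windowColor (w v : List ℕ) (q : ℕ × ℕ) : ℕ :=
  blockColor (w.getD q.1 0) (v.getD q.2 0)

theorem goodAt_windowColor : ∀ a < 4, ∀ b < 4, ∀ w ∈ wordsFrom 10 a, ∀ v ∈ wordsFrom 10 b,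
    GoodAt (windowColor w v) (5, 5) := by
  decide +kernel

/-- The position of the `t`-th cell of a `4 × 4` square in row-major order. -/
def cell (t : ℕ) : ℕ × ℕ := (t / 4 + 1, t % 4 + 1)

/-- The partial coloring of the square with coordinates `1, …, 4` in which `l` lists the colors
of the cells from the `n`-th one on; points without a color get `4`. -/
def suffixColor (n : ℕ) (l : List ℕ) (q : ℕ × ℕ) : ℕ :=
  if 1 ≤ q.1 ∧ q.1 ≤ 4 ∧ 1 ≤ q.2 ∧ q.2 ≤ 4 ∧ n ≤ 4 * (q.1 - 1) + (q.2 - 1) then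
    l.getD (4 * (q.1 - 1) + (q.2 - 1) - n) 4
  else 4

/-- The partial coloring `l` satisfies `GoodAt` at its first two cells. -/
def SuffixGood (n : ℕ) (l : List ℕ) : Prop :=
  ∀ t ∈ [n, n + 1], t < 16 → GoodAt (suffixColor n l) (cell t)

instance (n : ℕ) (l : List ℕ) : Decidable (SuffixGood n l) :=
  inferInstanceAs (Decidable (∀ t ∈ [n, n + 1], t < 16 → GoodAt (suffixColor n l) (cell t)))

/-- Backtracking search: no extension of `l` by `n` cells with colors `< 3` is good. -/
def noExtension : ℕ → List ℕ → Bool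
  | 0, _ => false
  | n + 1, l => [0, 1, 2].all fun c =>
      !decide (SuffixGood n (c :: l)) || noExtension n (c :: l)

theorem noExtension_pair : noExtension 14 [1, 0] = true := by
  decide +kernel

theorem isPkColoring_six_iff {V α : Type*} [DecidableEq α] {G : SimpleGraph V} {f : V → α} :
    IsPkColoring G 6 f ↔ ∀ u₀ u₁, G.Adj u₀ u₁ → f u₁ ≠ f u₀ ∧
      ∀ u₂, G.Adj u₁ u₂ → f u₂ = f u₀ → u₂ ≠ u₀ →
      ∀ u₃, G.Adj u₂ u₃ → f u₃ = f u₁ → u₃ ≠ u₁ →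
      ∀ u₄, G.Adj u₃ u₄ → f u₄ = f u₀ → u₄ ≠ u₂ → u₄ ≠ u₀ →
      ∀ u₅, G.Adj u₄ u₅ → f u₅ = f u₁ → u₅ ≠ u₃ → u₅ = u₁ := by
  constructor
  · rintro ⟨hf, hp⟩ u₀ u₁ h₁
    refine ⟨(hf _ _ h₁).symm, fun u₂ h₂ e₂ n₂ u₃ h₃ e₃ n₃ u₄ h₄ e₄ n₄ n₄' u₅ h₅ e₅ n₅ => ?_⟩
    by_contra n₅'
    have hne := hf _ _ h₁
    have hd : ∀ {x y}, f x = f u₀ → f y = f u₁ → x ≠ y := by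
      rintro x y hx hy rfl
      exact hne (hx.symm.trans hy)
    have key := hp u₀ u₅ (.cons h₁ (.cons h₂ (.cons h₃ (.cons h₄ (.cons h₅ .nil))))) (by
      rw [Walk.isPath_def]
      simp only [Walk.support_cons, Walk.support_nil, List.nodup_cons, List.mem_cons,
        List.not_mem_nil, or_false, not_or, not_false_eq_true, List.nodup_nil, and_true]
      exact ⟨⟨hd rfl rfl, n₂.symm, hd rfl e₃, n₄'.symm, hd rfl e₅⟩,
        ⟨(hd e₂ rfl).symm, n₃.symm, (hd e₄ rfl).symm, Ne.symm n₅'⟩,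
        ⟨hd e₂ e₃, n₄.symm, hd e₂ e₅⟩, ⟨(hd e₄ e₃).symm, n₅.symm⟩, hd e₄ e₅⟩) rfl
    have hsub : (List.map f (Walk.support (.cons h₁ (.cons h₂ (.cons h₃ (.cons h₄
        (.cons h₅ .nil))))))).toFinset ⊆ {f u₀, f u₁} := by
      intro x hx
      simp only [Walk.support_cons, Walk.support_nil, List.map_cons, List.map_nil,
        List.mem_toFinset, List.mem_cons, List.not_mem_nil, or_false, e₂, e₃, e₄, e₅] at hx
      rcases hx with h | h | h | h | h | h <;> simp [h]
    exact absurd (key.trans ((Finset.card_le_card hsub).trans Finset.card_le_two)) (by decide)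
  · intro H
    refine ⟨fun u w h => (H u w h).1.symm, fun u w p hp hl => ?_⟩
    by_contra hc
    have hmem : ∀ x ∈ p.support, ∀ y ∈ p.support, ∀ z ∈ p.support,
        f x ≠ f y → f z ≠ f y → f z = f x := by
      intro x hx y hy z hz hxy hzy
      by_contra hzx
      apply hc
      rw [← Finset.card_eq_three.2 ⟨f x, f y, f z, hxy, Ne.symm hzx, hzy.symm, rfl⟩]
      apply Finset.card_le_card
      intro a ha
      simp only [Finset.mem_insert, Finset.mem_singleton] at ha
      rw [List.mem_toFinset, List.mem_map]
      rcases ha with rfl | rfl | rfl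
      exacts [⟨x, hx, rfl⟩, ⟨y, hy, rfl⟩, ⟨z, hz, rfl⟩]
    rw [Walk.isPath_def] at hp
    obtain _ | @⟨_, u₁, _, h₁, p⟩ := p; · simp at hl
    obtain _ | @⟨_, u₂, _, h₂, p⟩ := p; · simp at hl
    obtain _ | @⟨_, u₃, _, h₃, p⟩ := p; · simp at hl
    obtain _ | @⟨_, u₄, _, h₄, p⟩ := p; · simp at hl
    obtain _ | @⟨_, _, _, h₅, p⟩ := p; · simp at hl
    obtain _ | @⟨_, _, _, h₆, p⟩ := p; swap; · simp at hl
    simp only [Walk.support_cons, Walk.support_nil, List.nodup_cons, List.mem_cons,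
      List.not_mem_nil, or_false, not_or, not_false_eq_true, List.nodup_nil, and_true]
      at hp hmem
    obtain ⟨⟨-, a₂, -, a₄, -⟩, ⟨-, b₃, -, b₅⟩, ⟨-, c₄, -⟩, ⟨-, d₅⟩, -⟩ := hp
    have n₁ := (H _ _ h₁).1
    have n₂ := (H _ _ h₂).1
    have n₃ := (H _ _ h₃).1
    have n₄ := (H _ _ h₄).1
    have n₅ := (H _ _ h₅).1
    have e₂ : f u₂ = f u := hmem u (by simp) u₁ (by simp) u₂ (by simp) n₁.symm n₂
    have e₃ : f u₃ = f u₁ := hmem u₁ (by simp) u₂ (by simp) u₃ (by simp) n₂.symm n₃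
    have e₄ : f u₄ = f u₂ := hmem u₂ (by simp) u₃ (by simp) u₄ (by simp) n₃.symm n₄
    have e₅ : f w = f u₃ := hmem u₃ (by simp) u₄ (by simp) w (by simp) n₄.symm n₅
    exact b₅ ((H u u₁ h₁).2 u₂ h₂ e₂ (Ne.symm a₂) u₃ h₃ e₃ (Ne.symm b₃) u₄ h₄ (e₄.trans e₂)
      (Ne.symm c₄) (Ne.symm a₄) w h₅ (e₅.trans e₃) (Ne.symm d₅)).symm

theorem IsPkColoring.comp_injective_s13 {V α β : Type*} [DecidableEq α] [DecidableEq β]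
    {G : SimpleGraph V} {k : ℕ} {f : V → α} (hf : IsPkColoring G k f) {e : α → β}
    (he : Function.Injective e) : IsPkColoring G k (e ∘ f) := by
  refine ⟨fun u w h h' => hf.1 u w h (he h'), fun u w p hp hl => ?_⟩
  have himage : (p.support.map (e ∘ f)).toFinset = (p.support.map f).toFinset.image e := by
    ext
    simp
  rw [himage, Finset.card_image_of_injective _ he]
  exact hf.2 u w p hp hl

/-- The vertex of the cycle on `m` vertices with number `k` modulo `m`. -/
def cycleVertex (m : ℕ) [NeZero m] (k : ℕ) : Fin m :=
  ⟨k % m, Nat.mod_lt _ (NeZero.pos m)⟩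

theorem cycleGraph_adj_iff_mod {m : ℕ} (hm : 3 ≤ m) {u v : Fin m} :
    (cycleGraph m).Adj u v ↔ v.val = (u.val + 1) % m ∨ u.val = (v.val + 1) % m := by
  have hu := u.isLt
  have hv := v.isLt
  rw [cycleGraph_adj', Fin.sub_def, Fin.sub_def]
  have red : ∀ x, x < 2 * m → x % m = if x < m then x else x - m := by
    intro x hx
    split_ifs with h
    · exact Nat.mod_eq_of_lt h
    · rw [Nat.mod_eq_sub_mod (by omega), Nat.mod_eq_of_lt (by omega)]
  simp only
  rw [red _ (by omega), red _ (by omega), red _ (by omega), red _ (by omega)]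
  split_ifs <;> omega

theorem cycleVertex_eq_iff {m : ℕ} [NeZero m] {k : ℕ} {v : Fin m} :
    v = cycleVertex m k ↔ v.val = k % m := Fin.ext_iff

theorem cycleGraph_adj_cycleVertex_succ {m : ℕ} [NeZero m] (hm : 3 ≤ m) (k : ℕ) :
    (cycleGraph m).Adj (cycleVertex m k) (cycleVertex m (k + 1)) := by
  rw [cycleGraph_adj_iff_mod hm]
  left
  simp [cycleVertex]

theorem eq_of_cycleGraph_adj_cycleVertex {m : ℕ} [NeZero m] (hm : 3 ≤ m) {k : ℕ} (hk : 1 ≤ k)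
    {v : Fin m} (h : (cycleGraph m).Adj (cycleVertex m k) v) :
    v = cycleVertex m (k + 1) ∨ v = cycleVertex m (k - 1) := by
  rw [cycleGraph_adj_iff_mod hm] at h
  simp only [cycleVertex_eq_iff]
  simp only [cycleVertex] at h
  refine h.imp (fun h => by simpa using h) fun h => ?_
  obtain ⟨k, rfl⟩ : ∃ j, k = j + 1 := ⟨k - 1, by omega⟩
  have : v.val ≡ k [MOD m] := Nat.ModEq.add_right_cancel' 1 h.symm
  rw [Nat.add_sub_cancel, ← this, Nat.mod_eq_of_lt v.isLt]

/-- The covering of the torus grid by the grid, shifted by `x` and `y`. -/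
def torusVertex (m n x y : ℕ) [NeZero m] [NeZero n] (q : ℕ × ℕ) : Fin m × Fin n :=
  (cycleVertex m (x + q.1), cycleVertex n (y + q.2))

section Torus

variable {m n : ℕ} [NeZero m] [NeZero n]

theorem exists_gridNbrs_of_adj (hm : 3 ≤ m) (hn : 3 ≤ n) {x y : ℕ} {q : ℕ × ℕ}
    (h₁ : 1 ≤ q.1) (h₂ : 1 ≤ q.2) {v : Fin m × Fin n}
    (h : ((cycleGraph m).boxProd (cycleGraph n)).Adj (torusVertex m n x y q) v) :
    ∃ q' ∈ gridNbrs q, v = torusVertex m n x y q' := by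
  obtain ⟨a, b⟩ := v
  rw [boxProd_adj] at h
  simp only [torusVertex] at h
  rcases h with ⟨h, rfl⟩ | ⟨h, rfl⟩
  · rcases eq_of_cycleGraph_adj_cycleVertex hm (by omega) h with rfl | rfl
    · exact ⟨(q.1 + 1, q.2), by simp [gridNbrs], rfl⟩
    · refine ⟨(q.1 - 1, q.2), by simp [gridNbrs], ?_⟩
      simp only [torusVertex, Nat.add_sub_assoc h₁]
  · rcases eq_of_cycleGraph_adj_cycleVertex hn (by omega) h with rfl | rfl
    · exact ⟨(q.1, q.2 + 1), by simp [gridNbrs], rfl⟩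
    · refine ⟨(q.1, q.2 - 1), by simp [gridNbrs], ?_⟩
      simp only [torusVertex, Nat.add_sub_assoc h₂]

theorem adj_torusVertex_of_mem_gridNbrs (hm : 3 ≤ m) (hn : 3 ≤ n) {x y : ℕ} {q q' : ℕ × ℕ}
    (h₁ : 1 ≤ q.1) (h₂ : 1 ≤ q.2) (h : q' ∈ gridNbrs q) :
    ((cycleGraph m).boxProd (cycleGraph n)).Adj (torusVertex m n x y q)
      (torusVertex m n x y q') := by
  obtain ⟨a, b⟩ := q
  obtain ⟨a, rfl⟩ : ∃ j, a = j + 1 := ⟨a - 1, by simp only at h₁; omega⟩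
  obtain ⟨b, rfl⟩ : ∃ j, b = j + 1 := ⟨b - 1, by simp only at h₂; omega⟩
  simp only [gridNbrs, Nat.add_sub_cancel, List.mem_cons, List.not_mem_nil, or_false] at h
  rw [boxProd_adj]
  rcases h with rfl | rfl | rfl | rfl
  · exact .inl ⟨cycleGraph_adj_cycleVertex_succ hm _, rfl⟩
  · exact .inl ⟨(cycleGraph_adj_cycleVertex_succ hm _).symm, rfl⟩
  · exact .inr ⟨cycleGraph_adj_cycleVertex_succ hn _, rfl⟩
  · exact .inr ⟨(cycleGraph_adj_cycleVertex_succ hn _).symm, rfl⟩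

theorem bounds_of_mem_gridNbrs {q q' : ℕ × ℕ} (h : q' ∈ gridNbrs q) :
    q.1 ≤ q'.1 + 1 ∧ q'.1 ≤ q.1 + 1 ∧ q.2 ≤ q'.2 + 1 ∧ q'.2 ≤ q.2 + 1 := by
  simp only [gridNbrs, List.mem_cons, List.not_mem_nil, or_false] at h
  rcases h with rfl | rfl | rfl | rfl <;> simp only <;> omega

end Torus

/-! ### The lower bound -/

theorem suffixColor_map_range' (h : ℕ → ℕ) (n : ℕ) (q : ℕ × ℕ)
    (hq : suffixColor n ((List.range' n (16 - n)).map h) q ≠ 4) :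
    (1 ≤ q.1 ∧ q.1 ≤ 4 ∧ 1 ≤ q.2 ∧ q.2 ≤ 4) ∧
      suffixColor n ((List.range' n (16 - n)).map h) q = h (4 * (q.1 - 1) + (q.2 - 1)) := by
  unfold suffixColor at hq ⊢
  split_ifs at hq ⊢ with hc
  · refine ⟨by tauto, ?_⟩
    rw [List.getD_eq_getElem _ _ (by simp; omega)]
    simp only [List.getElem_map, List.getElem_range']
    congr 1
    omega
  · exact absurd rfl hq

theorem noExtension_eq_false (h : ℕ → ℕ) (h_lt : ∀ t, h t < 3)
    (good : ∀ n < 16, SuffixGood n ((List.range' n (16 - n)).map h)) (n : ℕ) (hn : n ≤ 16) :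
    noExtension n ((List.range' n (16 - n)).map h) = false := by
  induction n with
  | zero => rfl
  | succ n ih =>
    have hg := good n (by omega)
    have ih := ih (by omega)
    have hl : List.range' n (16 - n) = n :: List.range' (n + 1) (16 - (n + 1)) := by
      rw [show 16 - n = (16 - (n + 1)) + 1 by omega, List.range'_succ]
    rw [hl, List.map_cons] at hg ih
    rw [noExtension, List.all_eq_false]
    refine ⟨h n, ?_, by rw [ih, decide_eq_true hg]; decide⟩
    have := h_lt n
    simp only [List.mem_cons, List.not_mem_nil, or_false]
    omega

theorem exists_perm_fin_three : ∀ a b : Fin 3, a ≠ b →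
    ∃ σ : Equiv.Perm (Fin 3), σ a = 0 ∧ σ b = 1 := by
  decide

theorem not_isPkColoring_fin_three_s13 {m n : ℕ} (hm : 4 ≤ m) (hn : 4 ≤ n)
    (f : Fin m × Fin n → Fin 3) :
    ¬ IsPkColoring ((cycleGraph m).boxProd (cycleGraph n)) 6 f := by
  intro hf
  have : NeZero m := ⟨by omega⟩
  have : NeZero n := ⟨by omega⟩
  let φ := torusVertex m n 0 0
  wlog hw : f (φ (cell 15)) = 0 ∧ f (φ (cell 14)) = 1 generalizing f
  · have hadj := adj_torusVertex_of_mem_gridNbrs (m := m) (n := n) (x := 0) (y := 0)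
      (q := cell 15) (q' := cell 14) (by omega) (by omega) (by decide) (by decide) (by decide)
    obtain ⟨σ, hσ⟩ := exists_perm_fin_three _ _ (hf.1 _ _ hadj)
    exact this (σ ∘ f) (hf.comp_injective_s13 σ.injective) hσ
  rw [isPkColoring_six_iff] at hf
  let h : ℕ → ℕ := fun t => (f (φ (cell t))).val
  have hinj : ∀ {q q' : ℕ × ℕ}, (1 ≤ q.1 ∧ q.1 ≤ 4 ∧ 1 ≤ q.2 ∧ q.2 ≤ 4) →
      (1 ≤ q'.1 ∧ q'.1 ≤ 4 ∧ 1 ≤ q'.2 ∧ q'.2 ≤ 4) → φ q = φ q' → q = q' := by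
    have aux : ∀ {k a b : ℕ}, 4 ≤ k → 1 ≤ a → a ≤ 4 → 1 ≤ b → b ≤ 4 → a % k = b % k → a = b := by
      intro k a b hk ha ha' hb hb' hab
      have hab : a ≡ b [MOD k] := hab
      rcases le_total a b with hle | hle
      · have := Nat.eq_zero_of_dvd_of_lt ((Nat.modEq_iff_dvd' hle).1 hab) (by omega)
        omega
      · have := Nat.eq_zero_of_dvd_of_lt ((Nat.modEq_iff_dvd' hle).1 hab.symm) (by omega)
        omega
    rintro ⟨a, b⟩ ⟨a', b'⟩ hq hq' he
    simp only [φ, torusVertex, cycleVertex, Prod.mk.injEq, Fin.mk.injEq, zero_add] at he hq hq' ⊢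
    exact ⟨aux hm (by omega) (by omega) (by omega) (by omega) he.1,
      aux hn (by omega) (by omega) (by omega) (by omega) he.2⟩
  have good : ∀ k < 16, SuffixGood k ((List.range' k (16 - k)).map h) := by
    intro k hk t ht ht16
    have htk : k ≤ t := by
      simp only [List.mem_cons, List.not_mem_nil, or_false] at ht
      omega
    have hcol : ∀ {q}, suffixColor k ((List.range' k (16 - k)).map h) q ≠ 4 →
        (1 ≤ q.1 ∧ q.1 ≤ 4 ∧ 1 ≤ q.2 ∧ q.2 ≤ 4) ∧
          suffixColor k ((List.range' k (16 - k)).map h) q = (f (φ q)).val := by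
      intro q hq
      obtain ⟨hb, he⟩ := suffixColor_map_range' h k q hq
      refine ⟨hb, he.trans ?_⟩
      have : cell (4 * (q.1 - 1) + (q.2 - 1)) = q := by
        ext <;> simp only [cell] <;> omega
      simp only [h, this]
    have hp : suffixColor k ((List.range' k (16 - k)).map h) (cell t) ≠ 4 := by
      have hlt := (f (φ (cell t))).isLt
      unfold suffixColor
      rw [if_pos (by simp only [cell]; omega), List.getD_eq_getElem _ _ (by simp [cell]; omega)]
      simp only [List.getElem_map, List.getElem_range']
      rw [show k + 1 * (4 * ((cell t).1 - 1) + ((cell t).2 - 1) - k) = t by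
        simp only [cell]; omega]
      simp only [h]
      omega
    generalize suffixColor k ((List.range' k (16 - k)).map h) = g at hcol hp
    generalize cell t = p at hp
    have hadj : ∀ {q q'}, g q ≠ 4 → q' ∈ gridNbrs q →
        ((cycleGraph m).boxProd (cycleGraph n)).Adj (φ q) (φ q') := by
      intro q q' hq hq'
      obtain ⟨hb, -⟩ := hcol hq
      exact adj_torusVertex_of_mem_gridNbrs (by omega) (by omega) (by omega) (by omega) hq'
    have heq : ∀ {q q'}, g q ≠ 4 → g q' = g q → f (φ q') = f (φ q) := by
      intro q q' hq he
      rw [Fin.ext_iff, ← (hcol hq).2, ← (hcol (he ▸ hq)).2, he]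
    have hne : ∀ {q q'}, g q ≠ 4 → g q' ≠ 4 → q' ≠ q → φ q' ≠ φ q :=
      fun hq hq' hqq he => hqq (hinj (hcol hq').1 (hcol hq).1 he)
    intro q₁ m₁
    by_cases c₁ : g q₁ = 4
    · exact ⟨fun he => hp (he ▸ c₁), fun hc => absurd c₁ hc⟩
    obtain ⟨H₁, H₂⟩ := hf _ _ (hadj hp m₁)
    refine ⟨fun he => H₁ (heq hp he), ?_⟩
    intro _ q₂ m₂ e₂ n₂ q₃ m₃ e₃ n₃ q₄ m₄ e₄ n₄ n₄' q₅ m₅ e₅ n₅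
    have c₂ : g q₂ ≠ 4 := e₂ ▸ hp
    have c₃ : g q₃ ≠ 4 := e₃ ▸ c₁
    have c₄ : g q₄ ≠ 4 := e₄ ▸ hp
    have c₅ : g q₅ ≠ 4 := e₅ ▸ c₁
    exact hinj (hcol c₅).1 (hcol c₁).1 <|
      H₂ _ (hadj c₁ m₂) (heq hp e₂) (hne hp c₂ n₂) _ (hadj c₂ m₃) (heq c₁ e₃) (hne c₁ c₃ n₃)
        _ (hadj c₃ m₄) (heq hp e₄) (hne c₂ c₄ n₄) (hne hp c₄ n₄')
        _ (hadj c₄ m₅) (heq c₁ e₅) (hne c₃ c₅ n₅)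
  have := noExtension_eq_false h (fun t => (f (φ (cell t))).isLt) good 14 (by omega)
  rw [show List.map h (List.range' 14 (16 - 14)) = [h 14, h 15] from rfl,
    show h 14 = 1 from congrArg Fin.val hw.2, show h 15 = 0 from congrArg Fin.val hw.1,
    noExtension_pair] at this
  exact absurd this (by decide)

/-! ### The upper bound -/

/-- The `t`-th letter of the word made of `a` blocks `012` followed by blocks `0123`. -/
def blockLetter (a t : ℕ) : ℕ :=
  if t < 3 * a then t % 3 else (t - 3 * a) % 4

theorem blockLetter_lt (a t : ℕ) : blockLetter a t < 4 := by
  unfold blockLetter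
  split_ifs <;> omega

theorem mem_nextLetters_iff {i j : ℕ} (hi : i < 4) :
    j ∈ nextLetters i ↔ j = i + 1 ∧ i < 3 ∨ j = 0 ∧ 2 ≤ i := by
  interval_cases i <;> simp [nextLetters]
  omega

theorem blockLetter_succ_mem (a b t : ℕ) (hpos : 0 < 3 * a + 4 * b) :
    blockLetter a ((t + 1) % (3 * a + 4 * b)) ∈
      nextLetters (blockLetter a (t % (3 * a + 4 * b))) := by
  rw [mem_nextLetters_iff (blockLetter_lt _ _), Nat.add_mod]
  have hs := Nat.mod_lt t hpos
  generalize t % (3 * a + 4 * b) = s at hs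
  rw [← Nat.add_mod_mod, Nat.mod_mod, Nat.add_mod_mod]
  rcases Nat.lt_or_ge (s + 1) (3 * a + 4 * b) with h | h
  · rw [Nat.mod_eq_of_lt h]
    unfold blockLetter
    split_ifs <;> omega
  · rw [show s + 1 = 3 * a + 4 * b by omega, Nat.mod_self]
    unfold blockLetter
    rcases Nat.eq_zero_or_pos b with rfl | hb <;> split_ifs <;> omega

theorem map_range_mem_wordsFrom (k : ℕ) (w : ℕ → ℕ) (hw : ∀ t, w (t + 1) ∈ nextLetters (w t)) :
    (List.range (k + 1)).map w ∈ wordsFrom k (w 0) := by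
  induction k generalizing w with
  | zero => simp [wordsFrom]
  | succ k ih =>
    rw [wordsFrom, List.mem_flatMap]
    refine ⟨w 1, hw 0, ?_⟩
    rw [List.mem_map]
    refine ⟨_, ih (fun t => w (t + 1)) fun t => hw (t + 1), ?_⟩
    rw [List.range_succ_eq_map (n := k + 1), List.map_cons, List.map_map]
    rfl

theorem blockColor_lt : ∀ i < 4, ∀ j < 4, blockColor i j < 4 := by
  decide

theorem exists_isPkColoring_fin_four (a b c d : ℕ) (hm : 3 ≤ 3 * a + 4 * b)
    (hn : 3 ≤ 3 * c + 4 * d) :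
    ∃ f : Fin (3 * a + 4 * b) × Fin (3 * c + 4 * d) → Fin 4,
      IsPkColoring ((cycleGraph _).boxProd (cycleGraph _)) 6 f := by
  have hstep := fun t => blockLetter_succ_mem a b t (by omega)
  have hstep' := fun t => blockLetter_succ_mem c d t (by omega)
  generalize 3 * a + 4 * b = m at *
  generalize 3 * c + 4 * d = n at *
  have : NeZero m := ⟨by omega⟩
  have : NeZero n := ⟨by omega⟩
  refine ⟨fun u => ⟨_, blockColor_lt _ (blockLetter_lt a u.1) _ (blockLetter_lt c u.2)⟩, ?_⟩
  rw [isPkColoring_six_iff]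
  intro u₀
  let x := u₀.1.val + 5 * m - 5
  let y := u₀.2.val + 5 * n - 5
  let φ := torusVertex m n x y
  let w := fun t => blockLetter a ((x + t) % m)
  let v := fun t => blockLetter c ((y + t) % n)
  have hw : (List.range 11).map w ∈ wordsFrom 10 (w 0) :=
    map_range_mem_wordsFrom 10 w fun t => hstep (x + t)
  have hv : (List.range 11).map v ∈ wordsFrom 10 (v 0) :=
    map_range_mem_wordsFrom 10 v fun t => hstep' (y + t)
  have hgood := goodAt_windowColor _ (blockLetter_lt a _) _ (blockLetter_lt c _) _ hw _ hv
  set g := windowColor ((List.range 11).map w) ((List.range 11).map v) with hg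
  have hcol : ∀ q : ℕ × ℕ, q.1 ≤ 10 → q.2 ≤ 10 →
      g q = blockColor (blockLetter a (φ q).1.val) (blockLetter c (φ q).2.val) := by
    intro q h₁ h₂
    simp only [hg, windowColor]
    rw [List.getD_eq_getElem _ _ (by simp; omega), List.getD_eq_getElem _ _ (by simp; omega)]
    simp only [List.getElem_map, List.getElem_range]
    rfl
  have h₀ : u₀ = φ (5, 5) := by
    have aux : ∀ {k : ℕ} [NeZero k] (z : Fin k), z = cycleVertex k (z.val + 5 * k - 5 + 5) := by
      intro k _ z
      have := NeZero.pos k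
      rw [cycleVertex_eq_iff, Nat.sub_add_cancel (by omega), Nat.add_mul_mod_self_right,
        Nat.mod_eq_of_lt z.isLt]
    exact Prod.ext (aux _) (aux _)
  rw [h₀]
  intro u₁ a₁
  obtain ⟨q₁, m₁, rfl⟩ := exists_gridNbrs_of_adj hm hn (by simp) (by simp) a₁
  have b₁ := bounds_of_mem_gridNbrs m₁
  simp only at b₁
  obtain ⟨H₁, H₂⟩ := hgood q₁ m₁
  have k₀ := hcol (5, 5) (by simp) (by simp)
  have k₁ := hcol q₁ (by omega) (by omega)
  simp only [ne_eq, Fin.mk.injEq]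
  refine ⟨fun he => H₁ (by rw [k₀, k₁]; exact he), ?_⟩
  have c₁ : g q₁ ≠ 4 := by
    rw [k₁]
    exact (blockColor_lt _ (blockLetter_lt _ _) _ (blockLetter_lt _ _)).ne
  intro u₂ a₂ e₂ n₂
  obtain ⟨q₂, m₂, rfl⟩ := exists_gridNbrs_of_adj hm hn (by omega) (by omega) a₂
  have b₂ := bounds_of_mem_gridNbrs m₂
  have k₂ := hcol q₂ (by omega) (by omega)
  intro u₃ a₃ e₃ n₃
  obtain ⟨q₃, m₃, rfl⟩ := exists_gridNbrs_of_adj hm hn (by omega) (by omega) a₃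
  have b₃ := bounds_of_mem_gridNbrs m₃
  have k₃ := hcol q₃ (by omega) (by omega)
  intro u₄ a₄ e₄ n₄ n₄'
  obtain ⟨q₄, m₄, rfl⟩ := exists_gridNbrs_of_adj hm hn (by omega) (by omega) a₄
  have b₄ := bounds_of_mem_gridNbrs m₄
  have k₄ := hcol q₄ (by omega) (by omega)
  intro u₅ a₅ e₅ n₅
  obtain ⟨q₅, m₅, rfl⟩ := exists_gridNbrs_of_adj hm hn (by omega) (by omega) a₅
  have b₅ := bounds_of_mem_gridNbrs m₅
  have k₅ := hcol q₅ (by omega) (by omega)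
  have hne : ∀ {q q' : ℕ × ℕ}, ¬ torusVertex m n x y q = torusVertex m n x y q' → q ≠ q' :=
    fun hq he => hq (he ▸ rfl)
  exact congrArg _ <|
    H₂ c₁ q₂ m₂ (by rw [k₂, k₀]; exact e₂) (hne n₂) q₃ m₃ (by rw [k₃, k₁]; exact e₃) (hne n₃)
      q₄ m₄ (by rw [k₄, k₀]; exact e₄) (hne n₄) (hne n₄') q₅ m₅ (by rw [k₅, k₁]; exact e₅) (hne n₅)

theorem exists_eq_three_mul_add_four_mul {m : ℕ} (hm : 4 ≤ m) (hm5 : m ≠ 5) :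
    ∃ a b, m = 3 * a + 4 * b := by
  by_cases h : m % 3 = 2
  · exact ⟨(m - 8) / 3, 2, by omega⟩
  · exact ⟨(m - 4 * (m % 3)) / 3, m % 3, by omega⟩

theorem s6_cycle_boxProd_cycle (m n : ℕ) (hm : 4 ≤ m) (hn : 4 ≤ n)
    (hm5 : m ≠ 5) (hn5 : n ≠ 5) :
    pkChrom ((cycleGraph m).boxProd (cycleGraph n)) 6 = 4 := by
  unfold pkChrom
  have hmem : 4 ∈ {k : ℕ | ∃ f : Fin m × Fin n → Fin k,
      IsPkColoring ((cycleGraph m).boxProd (cycleGraph n)) 6 f} := by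
    obtain ⟨a, b, rfl⟩ := exists_eq_three_mul_add_four_mul hm hm5
    obtain ⟨c, d, rfl⟩ := exists_eq_three_mul_add_four_mul hn hn5
    exact exists_isPkColoring_fin_four a b c d (by omega) (by omega)
  refine le_antisymm (Nat.sInf_le hmem) (le_csInf ⟨4, hmem⟩ ?_)
  rintro k ⟨f, hf⟩
  by_contra! hk
  exact not_isPkColoring_fin_three_s13 hm hn _
    (hf.comp_injective_s13 (Fin.castLE_injective (show k ≤ 3 by omega)))
end
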